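/- Let 1 < p1 < 2 < p2 ≤ ∞. Then there exists a constant c > 0, depending only on p1 and p2, such that for all N ∈ ℕ and all n ∈ ℕ with n ≤ N/4 one has c^{-1} min{1, N^{1−1/p1} n^{-1/2}} ≤ c_n(id : ℓ_{p1}^N → ℓ_{p2}^N) ≤ c min{1, N^{1−1/p1} n^{-1/2}}. -/

import Mathlib

open scoped ENNReal Classical

/-- The `ℓ_p` norm on `ℂ^N`, for `p ∈ [1, ∞]` (`p = ∞` gives the sup-norm). -/
noncomputable def lpNorm (p : ℝ≥0∞) {N : ℕ} (x : Fin N → ℂ) : ℝ :=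
  if p = ∞ then ⨆ i, ‖x i‖ else (∑ i, ‖x i‖ ^ p.toReal) ^ (1 / p.toReal)

/-- The `n`-th Gelfand number of the identity map `id : ℓ_{p1}^N → ℓ_{p2}^N`:
the infimum, over all (automatically closed) linear subspaces `M` of `ℓ_{p1}^N` of
codimension `< n`, of `sup { ‖x‖_{p2} : x ∈ M, ‖x‖_{p1} ≤ 1 }`. -/
noncomputable def gelfandLp (p1 p2 : ℝ≥0∞) (N n : ℕ) : ℝ :=
  sInf { r : ℝ | ∃ M : Submodule ℂ (Fin N → ℂ),
    Module.finrank ℂ ((Fin N → ℂ) ⧸ M) < n ∧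
    r = sSup { t : ℝ | ∃ x ∈ M, lpNorm p1 x ≤ 1 ∧ t = lpNorm p2 x } }

/-- The sign `±1` encoded by a Boolean. -/
noncomputable def boolSign (b : Bool) : ℝ := if b then 1 else -1

/-- The signed sum `∑ ± v i`. -/
noncomputable def signedSum {N : ℕ} (v : Fin N → ℝ) (e : Fin N → Bool) : ℝ :=
  ∑ i, boolSign (e i) * v i

theorem sum_exp_signedSum {N : ℕ} (v : Fin N → ℝ) :
    ∑ e, Real.exp (signedSum v e) = ∏ i, (2 * Real.cosh (v i)) := by
  have h : ∀ i, 2 * Real.cosh (v i) = ∑ b : Bool, Real.exp (boolSign b * v i) := by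
    intro i
    simp [boolSign, Real.cosh_eq]
    ring
  simp_rw [h, Finset.prod_univ_sum, Fintype.piFinset_univ, signedSum, Real.exp_sum]

theorem sum_cos_signedSum {N : ℕ} (v : Fin N → ℝ) :
    ∑ e, Real.cos (signedSum v e) = ∏ i, (2 * Real.cos (v i)) := by
  have h : ∀ i, ((2 * Real.cos (v i) : ℝ) : ℂ) =
      ∑ b : Bool, Complex.exp (boolSign b * v i * Complex.I) := by
    intro i
    simp [boolSign, Complex.cos]
    ring
  have key : ∑ e, Complex.exp (signedSum v e * Complex.I) =
      ((∏ i, (2 * Real.cos (v i)) : ℝ) : ℂ) := by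
    rw [Complex.ofReal_prod]
    simp_rw [h, Finset.prod_univ_sum, Fintype.piFinset_univ, signedSum, ← Complex.exp_sum,
      ← Finset.sum_mul]
    push_cast
    rfl
  have := congrArg Complex.re key
  rw [Complex.re_sum, Complex.ofReal_re] at this
  rw [← this]
  simp [Complex.exp_ofReal_mul_I_re]

theorem sum_exp_signedSum_le {N : ℕ} (v : Fin N → ℝ) :
    ∑ e, Real.exp (signedSum v e) ≤ 2 ^ N * Real.exp ((∑ i, v i ^ 2) / 2) := by
  rw [sum_exp_signedSum, Finset.prod_mul_distrib, Finset.sum_div, Real.exp_sum]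
  simp only [Finset.prod_const, Finset.card_univ, Fintype.card_fin]
  gcongr with i
  exact Real.cosh_le_exp_half_sq _

theorem signedSum_smul {N : ℕ} (t : ℝ) (v : Fin N → ℝ) (e : Fin N → Bool) :
    signedSum (fun i => t * v i) e = t * signedSum v e := by
  simp only [signedSum, Finset.mul_sum]
  exact Finset.sum_congr rfl fun i _ => by ring

theorem integrable_exp_neg_sq_add_mul (u : ℝ) :
    MeasureTheory.Integrable fun x : ℝ => Real.exp (-x ^ 2 + x * u) := by
  have h := (integrable_exp_neg_mul_sq (b := 1) one_pos).comp_sub_right (u / 2)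
  convert h.const_mul (Real.exp (u ^ 2 / 4)) using 2 with x
  rw [← Real.exp_add]
  ring_nf

theorem integral_exp_neg_sq_add_mul (u : ℝ) :
    ∫ x : ℝ, Real.exp (-x ^ 2 + x * u) = Real.exp (u ^ 2 / 4) * √Real.pi := by
  have h := MeasureTheory.integral_sub_right_eq_self
    (μ := MeasureTheory.volume) (fun x : ℝ => Real.exp (-1 * x ^ 2)) (u / 2)
  rw [integral_gaussian, div_one] at h
  rw [← h, ← MeasureTheory.integral_const_mul]
  congr 1 with x
  rw [← Real.exp_add]
  ring_nf

/-- Exponential moment of the square of a normalized Rademacher sum. -/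
theorem sum_exp_signedSum_sq_le {N : ℕ} (v : Fin N → ℝ) (hv : ∑ i, v i ^ 2 = 1) :
    ∑ e, Real.exp (signedSum v e ^ 2 / 4) ≤ 2 ^ N * 2 := by
  have hpi : 0 < √Real.pi := Real.sqrt_pos.2 Real.pi_pos
  have h2 : √(Real.pi / (1 / 2)) ≤ 2 * √Real.pi := by
    rw [Real.sqrt_le_left (by positivity), mul_pow, Real.sq_sqrt Real.pi_pos.le]
    linarith [Real.pi_pos]
  refine le_of_mul_le_mul_right ?_ hpi
  calc (∑ e, Real.exp (signedSum v e ^ 2 / 4)) * √Real.pi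
      = ∫ x : ℝ, ∑ e, Real.exp (-x ^ 2 + x * signedSum v e) := by
        rw [MeasureTheory.integral_finsetSum _
          fun e _ => integrable_exp_neg_sq_add_mul (signedSum v e), Finset.sum_mul]
        simp_rw [integral_exp_neg_sq_add_mul]
    _ ≤ ∫ x : ℝ, 2 ^ N * Real.exp (-(1 / 2) * x ^ 2) := by
        refine MeasureTheory.integral_mono
          (MeasureTheory.integrable_finsetSum _ fun e _ => integrable_exp_neg_sq_add_mul _)
          ((integrable_exp_neg_mul_sq (by norm_num)).const_mul _) fun x => ?_
        have h := sum_exp_signedSum_le fun i => x * v i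
        simp_rw [signedSum_smul, mul_pow, ← Finset.mul_sum, hv] at h
        simp_rw [Real.exp_add, ← Finset.mul_sum]
        calc _ ≤ Real.exp (-x ^ 2) * (2 ^ N * Real.exp (x ^ 2 * 1 / 2)) := by gcongr
          _ = _ := by
            rw [mul_left_comm, ← Real.exp_add]
            ring_nf
    _ = 2 ^ N * √(Real.pi / (1 / 2)) := by
        rw [MeasureTheory.integral_const_mul, integral_gaussian]
    _ ≤ 2 ^ N * 2 * √Real.pi := by
        rw [mul_assoc]
        gcongr

theorem exp_neg_sq_le_cos (x : ℝ) : Real.exp (-x ^ 2) ≤ 1 - 2 / 5 * (1 - Real.cos x) := by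
  have h1 : Real.exp (-x ^ 2) ≤ 1 / (1 + x ^ 2) := by
    rw [Real.exp_neg, ← one_div]
    exact one_div_le_one_div_of_le (by positivity) (by linarith [Real.add_one_le_exp (x ^ 2)])
  refine h1.trans ?_
  rw [div_le_iff₀ (by positivity)]
  have h2 := Real.one_sub_sq_div_two_le_cos (x := x)
  have h3 := Real.neg_one_le_cos x
  have h4 := sq_nonneg x
  rcases le_total (x ^ 2) 4 with h | h
  · nlinarith
  · nlinarith

/-- Small-ball estimate for normalized Rademacher sums. -/
theorem exists_sum_exp_neg_signedSum_sq_le :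
    ∃ β : ℝ, 0 < β ∧ ∀ (N : ℕ) (v : Fin N → ℝ), ∑ i, v i ^ 2 = 1 →
      ∑ e, Real.exp (-signedSum v e ^ 2) ≤ 2 ^ N * Real.exp (-2 * β) := by
  set γ : ℝ := 2 / Real.pi ^ 2 with hγ
  have hγ0 : 0 < γ := by have := Real.pi_pos; positivity
  set ρ : ℝ := 1 - 2 / 5 * (1 - Real.exp (-γ)) with hρ
  have hexp : Real.exp (-γ) < 1 := by rw [Real.exp_lt_one_iff]; linarith
  have hρ0 : 0 < ρ := by have := Real.exp_pos (-γ); rw [hρ]; linarith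
  have hρ1 : ρ < 1 := by rw [hρ]; linarith
  refine ⟨-Real.log ρ / 2, by have := Real.log_neg hρ0 hρ1; linarith, fun N v hv => ?_⟩
  have hcos : ∏ i, (2 * Real.cos (v i)) ≤ 2 ^ N * Real.exp (-γ) := by
    have habs : ∀ i, |v i| ≤ 1 := fun i => by
      rw [← sq_le_one_iff_abs_le_one, ← hv]
      exact Finset.single_le_sum (f := fun i => v i ^ 2) (fun i _ => sq_nonneg _)
        (Finset.mem_univ i)
    have : Real.exp (-γ) = ∏ i, Real.exp (-γ * v i ^ 2) := by
      rw [← Real.exp_sum, ← Finset.mul_sum, hv, mul_one]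
    rw [this, Finset.prod_mul_distrib]
    simp only [Finset.prod_const, Finset.card_univ, Fintype.card_fin]
    gcongr with i
    · intro i _
      have := abs_le.1 (habs i)
      have := Real.pi_gt_three
      exact Real.cos_nonneg_of_mem_Icc ⟨by linarith, by linarith⟩
    · have h := Real.cos_le_one_sub_mul_cos_sq (x := v i)
        ((habs i).trans (by linarith [Real.pi_gt_three]))
      have h' := Real.add_one_le_exp (-γ * v i ^ 2)
      rw [hγ] at *
      linarith
  have h2 : -2 * (-Real.log ρ / 2) = Real.log ρ := by ring
  rw [h2, Real.exp_log hρ0]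
  calc ∑ e, Real.exp (-signedSum v e ^ 2)
      ≤ ∑ e, (1 - 2 / 5 * (1 - Real.cos (signedSum v e))) :=
        Finset.sum_le_sum fun e _ => exp_neg_sq_le_cos _
    _ = 2 ^ N * (3 / 5) + 2 / 5 * ∏ i, (2 * Real.cos (v i)) := by
        rw [← sum_cos_signedSum, Finset.mul_sum]
        simp only [mul_sub, Finset.sum_sub_distrib, Finset.sum_const, Finset.card_univ,
          Fintype.card_pi, Fintype.card_bool, Finset.prod_const, Fintype.card_fin, nsmul_eq_mul]
        push_cast
        ring
    _ ≤ 2 ^ N * ρ := by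
        rw [hρ]
        linarith

/-- The squared Euclidean norm of the image of `v` under the sign matrix `A`. -/
noncomputable def signMatrixNormSq {m N : ℕ} (A : Fin m → Fin N → Bool) (v : Fin N → ℝ) : ℝ :=
  ∑ k, signedSum v (A k) ^ 2

theorem sum_prod_eq_pow_sum {m : ℕ} {α : Type*} [Fintype α] (f : α → ℝ) :
    ∑ A : Fin m → α, ∏ k, f (A k) = (∑ e, f e) ^ m := by
  have h := Finset.prod_univ_sum (fun _ : Fin m => (Finset.univ : Finset α)) (fun _ e => f e)
  rw [Fintype.piFinset_univ, Finset.prod_const, Finset.card_univ, Fintype.card_fin] at h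
  exact h.symm

theorem exists_normalized {N : ℕ} {v : Fin N → ℝ} (hv : v ≠ 0) :
    0 < ∑ i, v i ^ 2 ∧ ∑ i, ((√(∑ i, v i ^ 2))⁻¹ * v i) ^ 2 = 1 ∧
      ∀ e, signedSum (fun i => (√(∑ i, v i ^ 2))⁻¹ * v i) e ^ 2 =
        signedSum v e ^ 2 / ∑ i, v i ^ 2 := by
  have h0 : 0 < ∑ i, v i ^ 2 := by
    obtain ⟨i, hi⟩ := Function.ne_iff.1 hv
    exact Finset.sum_pos' (fun i _ => sq_nonneg _)
      ⟨i, Finset.mem_univ i, by have : v i ≠ 0 := hi; positivity⟩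
  have hs : (√(∑ i, v i ^ 2))⁻¹ ^ 2 = (∑ i, v i ^ 2)⁻¹ := by
    rw [inv_pow, Real.sq_sqrt h0.le]
  refine ⟨h0, ?_, fun e => ?_⟩
  · simp_rw [mul_pow, ← Finset.mul_sum]
    rw [hs, inv_mul_cancel₀ h0.ne']
  · rw [signedSum_smul, mul_pow, hs]
    field_simp

theorem sum_exp_signMatrixNormSq_le (m : ℕ) {N : ℕ} {v : Fin N → ℝ} (hv : v ≠ 0) :
    ∑ A : Fin m → Fin N → Bool, Real.exp (signMatrixNormSq A v / (∑ i, v i ^ 2) / 4) ≤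
      (2 ^ N) ^ m * 2 ^ m := by
  obtain ⟨-, h1, h2⟩ := exists_normalized hv
  have h := sum_exp_signedSum_sq_le _ h1
  simp_rw [h2] at h
  simp_rw [signMatrixNormSq, Finset.sum_div, Real.exp_sum]
  rw [sum_prod_eq_pow_sum (fun e => Real.exp (signedSum v e ^ 2 / (∑ i, v i ^ 2) / 4)),
    ← mul_pow]
  gcongr

theorem exists_sum_exp_neg_signMatrixNormSq_le :
    ∃ β : ℝ, 0 < β ∧ ∀ (m N : ℕ) (v : Fin N → ℝ), v ≠ 0 →
      ∑ A : Fin m → Fin N → Bool, Real.exp (-(signMatrixNormSq A v / ∑ i, v i ^ 2)) ≤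
        (2 ^ N) ^ m * Real.exp (-2 * β * m) := by
  obtain ⟨β, hβ, hβ'⟩ := exists_sum_exp_neg_signedSum_sq_le
  refine ⟨β, hβ, fun m N v hv => ?_⟩
  obtain ⟨-, h1, h2⟩ := exists_normalized hv
  have h := hβ' N _ h1
  simp_rw [h2] at h
  simp_rw [signMatrixNormSq, Finset.sum_div, ← Finset.sum_neg_distrib, Real.exp_sum]
  rw [sum_prod_eq_pow_sum (fun e => Real.exp (-(signedSum v e ^ 2 / ∑ i, v i ^ 2))),
    mul_comm _ (m : ℝ), Real.exp_nat_mul, ← mul_pow]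
  gcongr

/-- The integer points of the `ℓ_1`-ball of radius `s`. -/
noncomputable def intBall (N s : ℕ) : Finset (Fin N → ℤ) :=
  (Fintype.piFinset fun _ => Finset.Icc (-(s : ℤ)) s).filter fun v => ∑ i, |v i| ≤ s

theorem mem_intBall {N s : ℕ} {v : Fin N → ℤ} : v ∈ intBall N s ↔ ∑ i, |v i| ≤ s := by
  rw [intBall, Finset.mem_filter, Fintype.mem_piFinset, and_iff_right_iff_imp]
  intro h i
  rw [Finset.mem_Icc, ← abs_le]
  exact (Finset.single_le_sum (f := fun i => |v i|) (fun i _ => abs_nonneg _)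
    (Finset.mem_univ i)).trans h

theorem sum_Icc_pow_natAbs_le (s : ℕ) {t : ℝ} (ht0 : 0 ≤ t) (ht1 : t < 1) :
    ∑ k ∈ Finset.Icc (-(s : ℤ)) s, t ^ k.natAbs ≤ 1 + 2 * (t / (1 - t)) := by
  have hI : ∑ k ∈ Finset.Icc (-(s : ℤ)) s, t ^ k.natAbs =
      1 + 2 * ∑ k ∈ Finset.range s, t ^ (k + 1) := by
    induction s with
    | zero => simp
    | succ s ih =>
      have : Finset.Icc (-((s + 1 : ℕ) : ℤ)) ((s + 1 : ℕ) : ℤ) =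
          insert (-((s : ℤ) + 1)) (insert ((s : ℤ) + 1) (Finset.Icc (-(s : ℤ)) s)) := by
        ext k
        simp only [Finset.mem_Icc, Finset.mem_insert]
        omega
      rw [this, Finset.sum_insert, Finset.sum_insert, ih, Finset.sum_range_succ]
      · have h1 : (-((s : ℤ) + 1)).natAbs = s + 1 := by omega
        have h2 : ((s : ℤ) + 1).natAbs = s + 1 := by omega
        rw [h1, h2]
        ring
      · simp
      · simp
        omega
  rw [hI]
  gcongr
  simp_rw [pow_succ', ← Finset.mul_sum, div_eq_mul_inv]
  gcongr
  rw [← tsum_geometric_of_lt_one ht0 ht1]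
  exact (summable_geometric_of_lt_one ht0 ht1).sum_le_tsum _ fun _ _ => by positivity

theorem card_intBall_le {N s : ℕ} (hs : 1 ≤ s) (hsN : s ≤ N) :
    ((intBall N s).card : ℝ) ≤ Real.exp (s * Real.log (1 + N / s) + 2 * s) := by
  have hs0 : (0 : ℝ) < s := by exact_mod_cast hs
  have hN0 : (0 : ℝ) < N := by exact_mod_cast hs.trans hsN
  set t : ℝ := (1 + N / s : ℝ)⁻¹ with ht
  have hpos : (0 : ℝ) < 1 + N / s := by positivity
  have ht0 : 0 < t := by positivity
  have ht1 : t < 1 := inv_lt_one_of_one_lt₀ (by linarith [div_pos hN0 hs0])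
  have htt : t / (1 - t) = s / N := by
    rw [div_eq_div_iff (by linarith) hN0.ne', ht]
    field_simp
    ring
  have h1 : ((intBall N s).card : ℝ) * t ^ s ≤ (1 + 2 * (s / N)) ^ N := by
    calc ((intBall N s).card : ℝ) * t ^ s = ∑ v ∈ intBall N s, t ^ s := by simp
      _ ≤ ∑ v ∈ intBall N s, ∏ i, t ^ (v i).natAbs := by
        refine Finset.sum_le_sum fun v hv => ?_
        rw [Finset.prod_pow_eq_pow_sum]
        refine pow_le_pow_of_le_one ht0.le ht1.le ?_
        have := mem_intBall.1 hv
        zify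
        simpa using this
      _ ≤ ∑ v ∈ Fintype.piFinset fun _ : Fin N => Finset.Icc (-(s : ℤ)) s,
          ∏ i, t ^ (v i).natAbs :=
        Finset.sum_le_sum_of_subset_of_nonneg (Finset.filter_subset _ _) fun _ _ _ => by
          positivity
      _ = (∑ k ∈ Finset.Icc (-(s : ℤ)) s, t ^ k.natAbs) ^ N := by
        have := Finset.prod_univ_sum (fun _ : Fin N => Finset.Icc (-(s : ℤ)) s)
          (fun _ k => t ^ k.natAbs)
        simpa using this.symm
      _ ≤ (1 + 2 * (s / N)) ^ N := by
        have := sum_Icc_pow_natAbs_le s ht0.le ht1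
        rw [htt] at this
        exact pow_le_pow_left₀ (Finset.sum_nonneg fun _ _ => by positivity) this _
  have h2 : (1 + 2 * (s / N) : ℝ) ^ N ≤ Real.exp (2 * s) := by
    have h := Real.add_one_le_exp (2 * (s / N) : ℝ)
    calc (1 + 2 * (s / N) : ℝ) ^ N ≤ Real.exp (2 * (s / N)) ^ N := by
          gcongr
          linarith
      _ = Real.exp (2 * s) := by
          rw [← Real.exp_nat_mul]
          field_simp
  have h3 : t ^ s = Real.exp (-(s * Real.log (1 + N / s))) := by
    rw [Real.exp_neg, Real.exp_nat_mul, Real.exp_log hpos, ht, inv_pow]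
  rw [h3] at h1
  rw [Real.exp_add, mul_comm]
  calc ((intBall N s).card : ℝ)
      = (intBall N s).card * Real.exp (-(s * Real.log (1 + N / s))) *
          Real.exp (s * Real.log (1 + N / s)) := by
        rw [mul_assoc, ← Real.exp_add]
        simp
    _ ≤ _ := by
        gcongr
        exact h1.trans h2

theorem card_intBall_le_rpow {δ : ℝ} (hδ0 : 0 < δ) (hδ1 : δ ≤ 1) {N s : ℕ} (hs : 1 ≤ s)
    (hsN : s ≤ N) :
    ((intBall N s).card : ℝ) ≤
      Real.exp ((2 / δ + 2) * ((N : ℝ) ^ δ * (s : ℝ) ^ (1 - δ))) := by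
  have hs0 : (0 : ℝ) < s := by exact_mod_cast hs
  have hN0 : (0 : ℝ) < N := by exact_mod_cast hs.trans hsN
  have hsN' : (s : ℝ) ≤ N := by exact_mod_cast hsN
  refine (card_intBall_le hs hsN).trans (Real.exp_le_exp.2 ?_)
  have hr : 1 ≤ (N : ℝ) / s := (one_le_div hs0).2 hsN'
  have hkey : (s : ℝ) * ((N : ℝ) / s) ^ δ = (N : ℝ) ^ δ * (s : ℝ) ^ (1 - δ) := by
    rw [Real.div_rpow hN0.le hs0.le, Real.rpow_sub hs0, Real.rpow_one]
    ring
  have hlog : Real.log (1 + N / s) ≤ 2 / δ * ((N : ℝ) / s) ^ δ := by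
    calc Real.log (1 + N / s) ≤ Real.log (2 * (N / s)) :=
          Real.log_le_log (by positivity) (by linarith)
      _ ≤ (2 * (N / s)) ^ δ / δ := Real.log_le_rpow_div (by positivity) hδ0
      _ ≤ 2 / δ * ((N : ℝ) / s) ^ δ := by
        rw [Real.mul_rpow (by norm_num) (by positivity), div_mul_eq_mul_div]
        gcongr
        calc (2 : ℝ) ^ δ ≤ 2 ^ (1 : ℝ) := Real.rpow_le_rpow_of_exponent_le (by norm_num) hδ1
          _ = 2 := Real.rpow_one _
  have h1 : 1 ≤ ((N : ℝ) / s) ^ δ := Real.one_le_rpow hr hδ0.le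
  rw [← hkey]
  nlinarith

theorem le_natCast_rpow_mul_rpow {δ : ℝ} (hδ0 : 0 ≤ δ) {N s : ℕ} (hsN : s ≤ N) (hs : 1 ≤ s) :
    (s : ℝ) ≤ (N : ℝ) ^ δ * (s : ℝ) ^ (1 - δ) := by
  have hs0 : (0 : ℝ) < s := by exact_mod_cast hs
  calc (s : ℝ) = (s : ℝ) ^ δ * (s : ℝ) ^ (1 - δ) := by
        rw [← Real.rpow_add hs0]
        simp
    _ ≤ _ := by gcongr

theorem intCast_comp_ne_zero {N : ℕ} {v : Fin N → ℤ} (hv : v ≠ 0) :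
    (fun i => (v i : ℝ)) ≠ 0 := by
  contrapose! hv
  ext i
  simpa using congrFun hv i

/-- Some sign matrix is bounded below on the integer points of a small `ℓ_1`-ball, and
bounded above on the integer points of every `ℓ_1`-ball. -/
theorem exists_signMatrix {δ : ℝ} (hδ0 : 0 < δ) (hδ1 : δ ≤ 1) :
    ∃ β C : ℝ, 0 < β ∧ 0 < C ∧ ∀ m N S : ℕ, 1 ≤ m → S ≤ N →
      (N : ℝ) ^ δ * (S : ℝ) ^ (1 - δ) ≤ β * m →
      ∃ A : Fin m → Fin N → Bool,
        (∀ v : Fin N → ℤ, ∑ i, |v i| ≤ S →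
          β * m * ∑ i, (v i : ℝ) ^ 2 ≤ signMatrixNormSq A fun i => (v i : ℝ)) ∧
        ∀ s : ℕ, s ≤ N → ∀ v : Fin N → ℤ, ∑ i, |v i| ≤ s →
          signMatrixNormSq A (fun i => (v i : ℝ)) ≤
            C * (m + (N : ℝ) ^ δ * (s : ℝ) ^ (1 - δ)) * ∑ i, (v i : ℝ) ^ 2 := by
  obtain ⟨β, hβ, hlow⟩ := exists_sum_exp_neg_signMatrixNormSq_le
  set D : ℝ := 2 / δ + 2 with hD
  have hD2 : 2 ≤ D := by
    have : 0 < 2 / δ := by positivity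
    linarith
  set ρ : ℝ := Real.exp (-(β / 2)) with hρ
  have hρ1 : ρ < 1 := by rw [hρ, Real.exp_lt_one_iff]; linarith
  obtain ⟨B, hB0, hB⟩ : ∃ B : ℝ, 0 ≤ B ∧ Real.exp (-B) < 1 - ρ := by
    have h := Real.tendsto_exp_neg_atTop_nhds_zero.eventually_lt_const (sub_pos.2 hρ1)
    obtain ⟨B, h1, h2⟩ := (h.and (Filter.eventually_ge_atTop 0)).exists
    exact ⟨B, h2, h1⟩
  set T : ℝ := B + 1 + D with hT
  refine ⟨β / (2 * D), 4 * T, by positivity, by positivity, fun m N S hm hSN hS => ?_⟩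
  have hm1 : (1 : ℝ) ≤ m := by exact_mod_cast hm
  set P : ℝ := (2 ^ N) ^ m with hP
  have hP0 : 0 < P := by positivity
  set F : ℕ → ℝ := fun s => (N : ℝ) ^ δ * (s : ℝ) ^ (1 - δ) with hF
  set Φ : (Fin m → Fin N → Bool) → ℝ := fun A =>
    (∑ v ∈ (intBall N S).erase 0, Real.exp (β / 2 * m) *
      Real.exp (-(signMatrixNormSq A (fun i => (v i : ℝ)) / ∑ i, (v i : ℝ) ^ 2))) +
    ∑ s ∈ Finset.Icc 1 N, ∑ v ∈ (intBall N s).erase 0, Real.exp (-(T * (m + F s))) *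
      Real.exp (signMatrixNormSq A (fun i => (v i : ℝ)) / (∑ i, (v i : ℝ) ^ 2) / 4) with hΦ
  have hfirst : ∑ v ∈ (intBall N S).erase 0, Real.exp (β / 2 * m) *
      (P * Real.exp (-2 * β * m)) ≤ P * ρ := by
    rcases Nat.eq_zero_or_pos S with rfl | hSpos
    · have : (intBall N 0).erase 0 = ∅ := by
        ext v
        simp only [Finset.mem_erase, mem_intBall, Finset.notMem_empty, iff_false, not_and]
        intro hv h
        refine hv (funext fun i => ?_)
        have := (Finset.single_le_sum (f := fun i => |v i|) (fun i _ => abs_nonneg _)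
          (Finset.mem_univ i)).trans h
        simpa using this
      rw [this, Finset.sum_empty]
      positivity
    · have hc : (((intBall N S).erase 0).card : ℝ) ≤ Real.exp (β / 2 * m) := by
        calc (((intBall N S).erase 0).card : ℝ) ≤ (intBall N S).card := by
              exact_mod_cast Finset.card_erase_le
          _ ≤ _ := card_intBall_le_rpow hδ0 hδ1 hSpos hSN
          _ ≤ _ := by
            refine Real.exp_le_exp.2 ?_
            calc D * ((N : ℝ) ^ δ * (S : ℝ) ^ (1 - δ)) ≤ D * (β / (2 * D) * m) := by gcongr
              _ = β / 2 * m := by field_simp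
      rw [Finset.sum_const, nsmul_eq_mul]
      calc _ ≤ Real.exp (β / 2 * m) * (Real.exp (β / 2 * m) * (P * Real.exp (-2 * β * m))) := by
            gcongr
        _ = P * Real.exp (-(β * m)) := by
            rw [mul_left_comm _ P, mul_left_comm _ P, ← Real.exp_add, ← Real.exp_add]
            ring_nf
        _ ≤ P * ρ := by
            refine mul_le_mul_of_nonneg_left (Real.exp_le_exp.2 ?_) hP0.le
            nlinarith
  have hsecond : ∑ s ∈ Finset.Icc 1 N, ∑ v ∈ (intBall N s).erase 0,
      Real.exp (-(T * (m + F s))) * (P * 2 ^ m) ≤ P * Real.exp (-B) := by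
    have hterm : ∀ s ∈ Finset.Icc 1 N, ∑ v ∈ (intBall N s).erase 0,
        Real.exp (-(T * (m + F s))) * (P * 2 ^ m) ≤ P * Real.exp (-B) * (1 / 2) ^ s := by
      intro s hs
      rw [Finset.mem_Icc] at hs
      have hFs : (s : ℝ) ≤ F s := le_natCast_rpow_mul_rpow hδ0.le hs.2 hs.1
      have hs1 : (1 : ℝ) ≤ s := by exact_mod_cast hs.1
      have hc : (((intBall N s).erase 0).card : ℝ) ≤ Real.exp (D * F s) := by
        calc (((intBall N s).erase 0).card : ℝ) ≤ (intBall N s).card := by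
              exact_mod_cast Finset.card_erase_le
          _ ≤ _ := card_intBall_le_rpow hδ0 hδ1 hs.1 hs.2
      have he : (2 : ℝ) ≤ Real.exp 1 := by linarith [Real.add_one_le_exp (1 : ℝ)]
      have h2m : (2 : ℝ) ^ m ≤ Real.exp m := by
        rw [← mul_one (m : ℝ), Real.exp_nat_mul]
        gcongr
      have h2s : Real.exp (-s) ≤ (1 / 2 : ℝ) ^ s := by
        rw [Real.exp_neg, ← mul_one (s : ℝ), Real.exp_nat_mul, ← inv_pow, one_div]
        gcongr
      rw [Finset.sum_const, nsmul_eq_mul]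
      calc _ ≤ Real.exp (D * F s) * (Real.exp (-(T * (m + F s))) * (P * Real.exp m)) := by
            gcongr
        _ = P * Real.exp (D * F s - T * (m + F s) + m) := by
            rw [mul_left_comm _ P, mul_left_comm _ P, ← Real.exp_add, ← Real.exp_add]
            ring_nf
        _ ≤ P * Real.exp (-B + -s) := by
            refine mul_le_mul_of_nonneg_left (Real.exp_le_exp.2 ?_) hP0.le
            rw [hT]
            nlinarith
        _ ≤ _ := by
            rw [Real.exp_add, mul_assoc]
            gcongr
    refine (Finset.sum_le_sum hterm).trans ?_
    rw [← Finset.mul_sum]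
    refine mul_le_of_le_one_right (by positivity) ?_
    have hgeom : ∀ n : ℕ, ∑ s ∈ Finset.Icc 1 n, (1 / 2 : ℝ) ^ s = 1 - (1 / 2) ^ n := by
      intro n
      induction n with
      | zero => simp
      | succ n ih =>
        rw [Finset.sum_Icc_succ_top (by omega), ih]
        ring
    rw [hgeom]
    have : (0 : ℝ) ≤ (1 / 2) ^ N := by positivity
    linarith
  have htotal : ∑ A, Φ A < P := by
    calc ∑ A, Φ A ≤ P * ρ + P * Real.exp (-B) := by
          rw [hΦ, Finset.sum_add_distrib]
          refine add_le_add (le_trans ?_ hfirst) (le_trans ?_ hsecond)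
          · rw [Finset.sum_comm]
            refine Finset.sum_le_sum fun v hv => ?_
            rw [← Finset.mul_sum]
            gcongr
            exact hlow m N _ (intCast_comp_ne_zero (Finset.ne_of_mem_erase hv))
          · rw [Finset.sum_comm]
            refine Finset.sum_le_sum fun s _ => ?_
            rw [Finset.sum_comm]
            refine Finset.sum_le_sum fun v hv => ?_
            rw [← Finset.mul_sum]
            gcongr
            exact sum_exp_signMatrixNormSq_le m
              (intCast_comp_ne_zero (Finset.ne_of_mem_erase hv))
      _ < P := by nlinarith
  obtain ⟨A, -, hA⟩ : ∃ A ∈ Finset.univ, Φ A < 1 := by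
    refine Finset.exists_lt_of_sum_lt (htotal.trans_le ?_)
    simp [hP, Fintype.card_pi]
  have hA1 : ∑ v ∈ (intBall N S).erase 0, Real.exp (β / 2 * m) *
      Real.exp (-(signMatrixNormSq A (fun i => (v i : ℝ)) / ∑ i, (v i : ℝ) ^ 2)) < 1 :=
    lt_of_le_of_lt (le_add_of_nonneg_right
      (Finset.sum_nonneg fun _ _ => Finset.sum_nonneg fun _ _ => by positivity)) hA
  have hA2 : ∑ s ∈ Finset.Icc 1 N, ∑ v ∈ (intBall N s).erase 0, Real.exp (-(T * (m + F s))) *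
      Real.exp (signMatrixNormSq A (fun i => (v i : ℝ)) / (∑ i, (v i : ℝ) ^ 2) / 4) < 1 :=
    lt_of_le_of_lt (le_add_of_nonneg_left
      (Finset.sum_nonneg fun _ _ => by positivity)) hA
  have hzero : signMatrixNormSq A (fun _ => (0 : ℝ)) = 0 := by
    simp [signMatrixNormSq, signedSum]
  refine ⟨A, fun v hv => ?_, fun s hsN v hv => ?_⟩
  · rcases eq_or_ne v 0 with rfl | hv0
    · simp [hzero]
    have h := (Finset.single_le_sum (fun w _ => by positivity)
      (Finset.mem_erase.2 ⟨hv0, mem_intBall.2 hv⟩)).trans_lt hA1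
    rw [← Real.exp_add, Real.exp_lt_one_iff] at h
    have hpos := (exists_normalized (intCast_comp_ne_zero hv0)).1
    have h' : β / 2 * m < signMatrixNormSq A (fun i => (v i : ℝ)) / ∑ i, (v i : ℝ) ^ 2 := by
      linarith
    rw [lt_div_iff₀ hpos] at h'
    refine le_trans ?_ h'.le
    gcongr
    linarith
  · rcases eq_or_ne v 0 with rfl | hv0
    · simp [hzero]
    have hs1 : 1 ≤ s := by
      by_contra! hs
      obtain rfl : s = 0 := by omega
      refine hv0 (funext fun i => ?_)
      have := (Finset.single_le_sum (f := fun i => |v i|) (fun i _ => abs_nonneg _)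
        (Finset.mem_univ i)).trans hv
      simpa using this
    have h := (Finset.single_le_sum (fun w _ => Finset.sum_nonneg fun _ _ => by positivity)
      (Finset.mem_Icc.2 ⟨hs1, hsN⟩)).trans_lt hA2
    have h := (Finset.single_le_sum (fun w _ => by positivity)
      (Finset.mem_erase.2 ⟨hv0, mem_intBall.2 hv⟩)).trans_lt h
    rw [← Real.exp_add, Real.exp_lt_one_iff] at h
    have hpos := (exists_normalized (intCast_comp_ne_zero hv0)).1
    have h' : signMatrixNormSq A (fun i => (v i : ℝ)) / (∑ i, (v i : ℝ) ^ 2) <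
        4 * T * (m + F s) := by
      linarith
    exact ((div_lt_iff₀ hpos).1 h').le

/-- Truncation of a real number towards zero. -/
noncomputable def truncInt (y : ℝ) : ℤ := if 0 ≤ y then ⌊y⌋ else ⌈y⌉

theorem abs_truncInt_le (y : ℝ) : |(truncInt y : ℝ)| ≤ |y| := by
  unfold truncInt
  split_ifs with h
  · rw [abs_of_nonneg h, abs_of_nonneg (by exact_mod_cast Int.floor_nonneg.2 h)]
    exact Int.floor_le y
  · have h' : ⌈y⌉ ≤ 0 := Int.ceil_le.2 (by push_cast; linarith)
    rw [abs_of_nonpos (not_le.1 h).le, abs_of_nonpos (by exact_mod_cast h')]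
    linarith [Int.le_ceil y]

theorem abs_sub_truncInt_le_one (y : ℝ) : |y - truncInt y| ≤ 1 := by
  unfold truncInt
  rw [abs_le]
  split_ifs with h
  · constructor <;> linarith [Int.floor_le y, Int.lt_floor_add_one y]
  · constructor <;> linarith [Int.le_ceil y, Int.ceil_lt_add_one y]

theorem abs_sub_truncInt_le_abs (y : ℝ) : |y - truncInt y| ≤ |y| := by
  unfold truncInt
  split_ifs with h
  · have h' : (0 : ℝ) ≤ ⌊y⌋ := by exact_mod_cast Int.floor_nonneg.2 h
    rw [abs_of_nonneg h, abs_of_nonneg (by linarith [Int.floor_le y])]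
    linarith
  · have h' : ((⌈y⌉ : ℤ) : ℝ) ≤ 0 := by
      exact_mod_cast Int.ceil_le.2 (by push_cast; linarith)
    rw [abs_of_nonpos (not_le.1 h).le, abs_of_nonpos (by linarith [Int.le_ceil y])]
    linarith

theorem abs_truncInt_two_mul_sub_le_one (y : ℝ) : |truncInt (2 * y) - 2 * truncInt y| ≤ 1 := by
  unfold truncInt
  rw [abs_le]
  by_cases h : 0 ≤ y
  · rw [if_pos h, if_pos (by linarith)]
    have h1 := Int.floor_le y
    have h2 := Int.lt_floor_add_one y
    have h3 := Int.floor_le (2 * y)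
    have h4 := Int.lt_floor_add_one (2 * y)
    have h5 : ((⌊2 * y⌋ : ℤ) : ℝ) < (2 * ⌊y⌋ + 2 : ℤ) := by push_cast; linarith
    have h6 : ((2 * ⌊y⌋ : ℤ) : ℝ) < (⌊2 * y⌋ + 1 : ℤ) := by push_cast; linarith
    have h5 := Int.cast_lt.1 h5
    have h6 := Int.cast_lt.1 h6
    omega
  · rw [if_neg h, if_neg (by linarith)]
    have h1 := Int.le_ceil y
    have h2 := Int.ceil_lt_add_one y
    have h3 := Int.le_ceil (2 * y)
    have h4 := Int.ceil_lt_add_one (2 * y)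
    have h5 : ((⌈2 * y⌉ : ℤ) : ℝ) < (2 * ⌈y⌉ + 1 : ℤ) := by push_cast; linarith
    have h6 : ((2 * ⌈y⌉ : ℤ) : ℝ) < (⌈2 * y⌉ + 2 : ℤ) := by push_cast; linarith
    have h5 := Int.cast_lt.1 h5
    have h6 := Int.cast_lt.1 h6
    omega

theorem truncInt_eq_zero {y : ℝ} (hy : |y| < 1) : truncInt y = 0 := by
  have h : ((|truncInt y| : ℤ) : ℝ) < (1 : ℤ) := by
    push_cast
    exact (abs_truncInt_le y).trans_lt hy
  have := Int.cast_lt.1 h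
  exact abs_eq_zero.1 (by have := abs_nonneg (truncInt y); omega)

theorem abs_truncInt_two_mul_sub_le_rpow {p : ℝ} (hp : 0 ≤ p) (y : ℝ) :
    |((truncInt (2 * y) - 2 * truncInt y : ℤ) : ℝ)| ≤ |2 * y| ^ p := by
  rcases lt_or_ge |2 * y| 1 with h | h
  · have h' : |y| < 1 := by
      rw [abs_mul, abs_two] at h
      linarith [abs_nonneg y]
    rw [truncInt_eq_zero h, truncInt_eq_zero h']
    simp
    positivity
  · refine le_trans ?_ (Real.one_le_rpow h hp)
    exact_mod_cast abs_truncInt_two_mul_sub_le_one y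

theorem abs_intCast_le_abs_rpow {p : ℝ} (hp : 1 ≤ p) (k : ℤ) : |(k : ℝ)| ≤ |(k : ℝ)| ^ p := by
  rcases eq_or_ne k 0 with rfl | hk
  · simp
    positivity
  · have h : (1 : ℝ) ≤ |(k : ℝ)| := by exact_mod_cast Int.one_le_abs hk
    exact Real.self_le_rpow_of_one_le h hp

theorem exists_telescoping_bound {γ : ℝ} (hγ0 : 0 < γ) (hγ1 : γ ≤ 1) :
    ∃ (K : ℝ) (R : ℝ → ℝ), 0 < K ∧ (∀ τ, 0 < τ → 0 ≤ R τ ∧ R τ ≤ K) ∧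
      ∀ τ, 0 < τ → min τ (τ ^ (-γ)) ≤ R (2 * τ) - R τ := by
  set g : ℝ := 2 ^ γ with hg
  have hg1 : 1 < g := Real.one_lt_rpow (by norm_num) hγ0
  set K : ℝ := 2 * (1 + g) / (g - 1) with hK
  have hg0 : 0 < g - 1 := by linarith
  have hK0 : 0 < K := by positivity
  refine ⟨K, fun τ => K * (τ ^ γ / (1 + τ ^ γ)), hK0, fun τ hτ => ⟨by positivity, ?_⟩,
    fun τ hτ => ?_⟩
  · refine mul_le_of_le_one_right hK0.le ?_
    rw [div_le_one (by positivity)]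
    linarith
  · have hr : 0 < τ ^ γ := by positivity
    beta_reduce
    rw [Real.mul_rpow (by norm_num) hτ.le, ← hg]
    set r := τ ^ γ with hr'
    have hdiff : K * (g * r / (1 + g * r)) - K * (r / (1 + r)) =
        2 * (1 + g) * r / ((1 + r) * (1 + g * r)) := by
      rw [hK]
      field_simp
      ring
    rw [hdiff, le_div_iff₀ (by positivity)]
    rcases le_total 1 τ with h | h
    · have hr1 : 1 ≤ r := Real.one_le_rpow h hγ0.le
      calc min τ (τ ^ (-γ)) * ((1 + r) * (1 + g * r))
          ≤ r⁻¹ * ((1 + r) * (1 + g * r)) := by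
            gcongr
            exact (min_le_right _ _).trans_eq (Real.rpow_neg hτ.le γ)
        _ ≤ r⁻¹ * ((2 * r) * ((1 + g) * r)) := by gcongr <;> nlinarith
        _ = 2 * (1 + g) * r := by field_simp
    · have hr1 : r ≤ 1 := Real.rpow_le_one hτ.le h hγ0.le
      calc min τ (τ ^ (-γ)) * ((1 + r) * (1 + g * r))
          ≤ r * ((1 + r) * (1 + g * r)) := by
            gcongr
            refine (min_le_left _ _).trans ?_
            calc τ = τ ^ (1 : ℝ) := (Real.rpow_one τ).symm
              _ ≤ τ ^ γ := Real.rpow_le_rpow_of_exponent_ge hτ h hγ1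
        _ ≤ r * (2 * (1 + g)) := by gcongr <;> nlinarith
        _ = 2 * (1 + g) * r := by ring

theorem sum_natFloor_of_real_le {N : ℕ} {v : Fin N → ℤ} {σ : ℝ}
    (h : ∑ i, |(v i : ℝ)| ≤ σ) : ∑ i, |v i| ≤ (⌊σ⌋₊ : ℤ) := by
  have h1 : ((∑ i, |v i| : ℤ) : ℝ) ≤ σ := by push_cast; exact h
  rw [Int.natCast_floor_eq_floor (le_trans (Finset.sum_nonneg fun i _ => abs_nonneg _) h)]
  exact Int.le_floor.2 h1

theorem norm_toLp_intCast_le {N : ℕ} {v : Fin N → ℤ} {σ : ℝ} (hv : ∀ i, |v i| ≤ 1)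
    (h : ∑ i, |(v i : ℝ)| ≤ σ) : ‖WithLp.toLp 2 fun i => (v i : ℝ)‖ ≤ √σ := by
  rw [EuclideanSpace.norm_eq]
  refine Real.sqrt_le_sqrt (le_trans (Finset.sum_le_sum fun i _ => ?_) h)
  have h1 : |(v i : ℝ)| ≤ 1 := by exact_mod_cast hv i
  simp only [Real.norm_eq_abs]
  nlinarith [abs_nonneg (v i : ℝ)]

/-- The exponent bookkeeping for one dyadic layer of thickness `t`. -/
theorem layer_bound {p : ℝ} (hp1 : 1 < p) {n t σ : ℝ} (hn : 0 < n) (ht : 0 < t)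
    (hσ0 : 0 ≤ σ) (hσn : σ ≤ n) (hσt : σ ≤ t ^ (-p)) (b μ : ℝ) (hb : 0 ≤ b) (hμ : 0 ≤ μ) :
    t * (b * (μ + n ^ ((1 - 1 / p) / 2) * σ ^ ((1 / p) / 2)) * √σ) ≤
      b * (μ * t ^ (1 - p / 2) + n ^ (1 - 1 / p) *
        min (t * n ^ (1 / p)) ((t * n ^ (1 / p)) ^ (-((p - 1) / 2)))) := by
  have hp0 : 0 < p := by linarith
  have h1 : t * √σ ≤ t ^ (1 - p / 2) := by
    calc t * √σ ≤ t ^ (1 : ℝ) * (t ^ (-p)) ^ (1 / 2 : ℝ) := by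
          rw [Real.sqrt_eq_rpow, Real.rpow_one]
          gcongr
      _ = t ^ (1 - p / 2) := by
          rw [← Real.rpow_mul ht.le, ← Real.rpow_add ht]
          ring_nf
  have hσσ : σ ^ ((1 / p) / 2) * √σ = σ ^ ((1 / p) / 2 + 1 / 2) := by
    rw [Real.sqrt_eq_rpow, Real.rpow_add_of_nonneg hσ0 (by positivity) (by norm_num)]
  have h2 : t * (n ^ ((1 - 1 / p) / 2) * (σ ^ ((1 / p) / 2) * √σ)) ≤
      n ^ (1 - 1 / p) * min (t * n ^ (1 / p)) ((t * n ^ (1 / p)) ^ (-((p - 1) / 2))) := by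
    rw [hσσ, mul_min_of_nonneg _ _ (by positivity)]
    refine le_min ?_ ?_
    · calc t * (n ^ ((1 - 1 / p) / 2) * σ ^ ((1 / p) / 2 + 1 / 2))
          ≤ t * (n ^ ((1 - 1 / p) / 2) * n ^ ((1 / p) / 2 + 1 / 2)) := by gcongr
        _ = n ^ (1 - 1 / p) * (t * n ^ (1 / p)) := by
          rw [mul_left_comm _ t, ← Real.rpow_add hn, ← Real.rpow_add hn]
          ring_nf
    · calc t * (n ^ ((1 - 1 / p) / 2) * σ ^ ((1 / p) / 2 + 1 / 2))
          ≤ t ^ (1 : ℝ) * (n ^ ((1 - 1 / p) / 2) * (t ^ (-p)) ^ ((1 / p) / 2 + 1 / 2)) := by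
            rw [Real.rpow_one]
            gcongr
        _ = n ^ (1 - 1 / p) * (t * n ^ (1 / p)) ^ (-((p - 1) / 2)) := by
          rw [Real.mul_rpow ht.le (by positivity), ← Real.rpow_mul ht.le, ← Real.rpow_mul hn.le,
            mul_left_comm _ (n ^ _), ← Real.rpow_add ht, mul_left_comm _ (t ^ _),
            ← Real.rpow_add hn, mul_comm (n ^ _)]
          congr 2 <;> field_simp <;> ring
  calc _ = b * (μ * (t * √σ) + t * (n ^ ((1 - 1 / p) / 2) * (σ ^ ((1 / p) / 2) * √σ))) := by
        ring
    _ ≤ _ := by gcongr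

/-- If `L` is bounded below on the integer points of a small `ℓ_1`-ball and bounded above on those
of every `ℓ_1`-ball, then the `ℓ_p`-ball has small Euclidean radius on `ker L`. -/
theorem exists_norm_le_of_ker {p : ℝ} (hp1 : 1 < p) (hp2 : p < 2) :
    ∃ C : ℝ, 0 < C ∧ ∀ (N : ℕ) (_ : 1 ≤ N) (E : Type) [NormedAddCommGroup E] [NormedSpace ℝ E]
      (L : (Fin N → ℝ) →ₗ[ℝ] E) (h a b μ : ℝ), 0 < h → 0 < a → 0 ≤ b → 0 ≤ μ →
      (∀ v : Fin N → ℤ, ∑ i, |v i| ≤ (⌊h ^ (-p)⌋₊ : ℤ) →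
        a * ‖WithLp.toLp 2 fun i => (v i : ℝ)‖ ≤ ‖L fun i => (v i : ℝ)‖) →
      (∀ s : ℕ, s ≤ N → ∀ v : Fin N → ℤ, ∑ i, |v i| ≤ s →
        ‖L fun i => (v i : ℝ)‖ ≤ b * (μ + (N : ℝ) ^ ((1 - 1 / p) / 2) * (s : ℝ) ^ ((1 / p) / 2)) *
          ‖WithLp.toLp 2 fun i => (v i : ℝ)‖) →
      ∀ x : Fin N → ℝ, ∑ i, |x i| ^ p ≤ 1 → L x = 0 →
        ‖WithLp.toLp 2 x‖ ≤ h ^ (1 - p / 2) +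
          b / a * C * (μ * h ^ (1 - p / 2) + (N : ℝ) ^ (1 - 1 / p)) := by
  obtain ⟨K, R, hK0, hR, hRdiff⟩ := exists_telescoping_bound (γ := (p - 1) / 2)
    (by linarith) (by linarith)
  have hp0 : 0 < p := by linarith
  have hθ : 0 < 1 - p / 2 := by linarith
  have hg : 0 < (2 : ℝ) ^ (1 - p / 2) - 1 :=
    sub_pos.2 (Real.one_lt_rpow (by norm_num) hθ)
  set G : ℝ := ((2 : ℝ) ^ (1 - p / 2) - 1)⁻¹ with hG
  have hG0 : 0 < G := by positivity
  refine ⟨G + K, by positivity, fun N hN E _ _ L h a b μ hh ha hb hμ hlow hup x hx hLx => ?_⟩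
  have hN0 : (0 : ℝ) < N := by exact_mod_cast hN
  -- the potential controlling the sum over dyadic layers
  set Ψ : ℝ → ℝ := fun t => b * (μ * (G * t ^ (1 - p / 2)) +
    (N : ℝ) ^ (1 - 1 / p) * R (t * (N : ℝ) ^ (1 / p))) with hΨ
  set q : ℝ → Fin N → ℤ := fun t i => truncInt (x i / t) with hq
  set u : ℝ → Fin N → ℝ := fun t i => t * q t i with hu
  have hstep : ∀ t, 0 < t → ‖L (u (2 * t))‖ ≤ ‖L (u t)‖ + (Ψ (2 * t) - Ψ t) := by
    intro t ht
    set w : Fin N → ℤ := fun i => truncInt (2 * (x i / (2 * t))) -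
      2 * truncInt (x i / (2 * t)) with hw
    have hxt : ∀ i, 2 * (x i / (2 * t)) = x i / t := fun i => by field_simp
    have hdecomp : u (2 * t) = u t - t • fun i => (w i : ℝ) := by
      ext i
      simp only [hu, hq, hw, hxt, Pi.sub_apply, Pi.smul_apply, smul_eq_mul]
      push_cast
      ring
    have hw1 : ∀ i, |w i| ≤ 1 := fun i => abs_truncInt_two_mul_sub_le_one _
    set σ : ℝ := min N (t ^ (-p)) with hσ
    have hσ0 : 0 ≤ σ := by positivity
    have hsum : ∑ i, |(w i : ℝ)| ≤ σ := by
      refine le_min ?_ ?_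
      · calc ∑ i, |(w i : ℝ)| ≤ ∑ i : Fin N, (1 : ℝ) :=
              Finset.sum_le_sum fun i _ => by exact_mod_cast hw1 i
          _ = N := by simp
      · calc ∑ i, |(w i : ℝ)| ≤ ∑ i, |x i / t| ^ p :=
              Finset.sum_le_sum fun i _ => by
                rw [← hxt]
                exact abs_truncInt_two_mul_sub_le_rpow hp0.le _
          _ = (∑ i, |x i| ^ p) * t ^ (-p) := by
              rw [Finset.sum_mul]
              refine Finset.sum_congr rfl fun i _ => ?_
              rw [abs_div, abs_of_pos ht, Real.div_rpow (abs_nonneg _) ht.le,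
                Real.rpow_neg ht.le, div_eq_mul_inv]
          _ ≤ t ^ (-p) := mul_le_of_le_one_left (by positivity) hx
    have hLw : t * ‖L fun i => (w i : ℝ)‖ ≤ Ψ (2 * t) - Ψ t := by
      have h1 := hup ⌊σ⌋₊ (Nat.floor_le_of_le (min_le_left _ _)) w (sum_natFloor_of_real_le hsum)
      calc t * ‖L fun i => (w i : ℝ)‖
          ≤ t * (b * (μ + (N : ℝ) ^ ((1 - 1 / p) / 2) * σ ^ ((1 / p) / 2)) * √σ) := by
            refine mul_le_mul_of_nonneg_left (h1.trans ?_) ht.le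
            have h2 := Nat.floor_le hσ0
            gcongr
            exact norm_toLp_intCast_le hw1 hsum
        _ ≤ _ := layer_bound hp1 hN0 ht hσ0 (min_le_left _ _) (min_le_right _ _) b μ hb hμ
        _ ≤ b * (μ * (G * (2 * t) ^ (1 - p / 2) - G * t ^ (1 - p / 2)) + (N : ℝ) ^ (1 - 1 / p) *
            (R (2 * (t * (N : ℝ) ^ (1 / p))) - R (t * (N : ℝ) ^ (1 / p)))) := by
            gcongr
            · rw [Real.mul_rpow (by norm_num) ht.le]
              have hGg : G * ((2 : ℝ) ^ (1 - p / 2) - 1) = 1 := inv_mul_cancel₀ hg.ne'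
              refine le_of_eq ?_
              linear_combination -(t ^ (1 - p / 2)) * hGg
            · exact hRdiff _ (by positivity)
        _ = Ψ (2 * t) - Ψ t := by
            simp only [hΨ, mul_assoc]
            ring
    rw [hdecomp, map_sub, map_smul]
    refine (norm_sub_le _ _).trans ?_
    rw [norm_smul, Real.norm_of_nonneg ht.le]
    linarith
  have hiter : ∀ J : ℕ, ‖L (u h)‖ ≤ ‖L (u (h / 2 ^ J))‖ + (Ψ h - Ψ (h / 2 ^ J)) := by
    intro J
    induction J with
    | zero => simp
    | succ J ih =>
      have := hstep (h / 2 ^ (J + 1)) (by positivity)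
      have h2 : 2 * (h / 2 ^ (J + 1)) = h / 2 ^ J := by
        rw [pow_succ]
        field_simp
      rw [h2] at this
      linarith
  have hΨ0 : ∀ t, 0 < t → 0 ≤ Ψ t := fun t ht => by
    have := (hR (t * (N : ℝ) ^ (1 / p)) (by positivity)).1
    positivity
  have hux : ∀ t, 0 < t → ∀ i, |x i - u t i| ≤ t := fun t ht i => by
    have : x i - u t i = t * (x i / t - truncInt (x i / t)) := by
      simp only [hu, hq]
      field_simp
    rw [this, abs_mul, abs_of_pos ht]
    exact mul_le_of_le_one_right ht.le (abs_sub_truncInt_le_one _)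
  have hlim : Filter.Tendsto (fun J : ℕ => ‖L (u (h / 2 ^ J))‖) Filter.atTop (nhds 0) := by
    have hh0 : Filter.Tendsto (fun J : ℕ => h / 2 ^ J) Filter.atTop (nhds 0) := by
      have := (tendsto_pow_atTop_nhds_zero_of_lt_one (r := (1 / 2 : ℝ)) (by norm_num)
        (by norm_num)).const_mul h
      simpa [div_eq_mul_inv] using this
    have hu0 : Filter.Tendsto (fun J : ℕ => u (h / 2 ^ J)) Filter.atTop (nhds x) := by
      rw [tendsto_pi_nhds]
      intro i
      rw [tendsto_iff_dist_tendsto_zero]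
      refine squeeze_zero (fun _ => dist_nonneg) (fun J => ?_) hh0
      rw [dist_comm, Real.dist_eq]
      exact hux _ (by positivity) i
    have := ((LinearMap.continuous_of_finiteDimensional L).tendsto x).comp hu0
    simpa [hLx] using this.norm
  have hLu : ‖L (u h)‖ ≤ b * (G + K) * (μ * h ^ (1 - p / 2) + (N : ℝ) ^ (1 - 1 / p)) := by
    have h1 : ‖L (u h)‖ ≤ 0 + Ψ h := by
      refine ge_of_tendsto' (hlim.add_const (Ψ h)) fun J => ?_
      have := hiter J
      have := hΨ0 (h / 2 ^ J) (by positivity)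
      linarith
    have h2 := (hR (h * (N : ℝ) ^ (1 / p)) (by positivity)).2
    calc ‖L (u h)‖ ≤ Ψ h := by linarith
      _ ≤ b * (μ * (G * h ^ (1 - p / 2)) + (N : ℝ) ^ (1 - 1 / p) * K) := by
        simp only [hΨ]
        gcongr
      _ ≤ b * (μ * ((G + K) * h ^ (1 - p / 2)) + (N : ℝ) ^ (1 - 1 / p) * (G + K)) := by
        gcongr <;> linarith
      _ = _ := by ring
  have huq : u h = h • fun i => (q h i : ℝ) := rfl
  have hqsum : ∑ i, |(q h i : ℝ)| ≤ h ^ (-p) := by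
    calc ∑ i, |(q h i : ℝ)| ≤ ∑ i, |x i / h| ^ p :=
          Finset.sum_le_sum fun i _ => (abs_intCast_le_abs_rpow hp1.le _).trans
            (Real.rpow_le_rpow (abs_nonneg _) (abs_truncInt_le _) hp0.le)
      _ = (∑ i, |x i| ^ p) * h ^ (-p) := by
          rw [Finset.sum_mul]
          refine Finset.sum_congr rfl fun i _ => ?_
          rw [abs_div, abs_of_pos hh, Real.div_rpow (abs_nonneg _) hh.le,
            Real.rpow_neg hh.le, div_eq_mul_inv]
      _ ≤ h ^ (-p) := mul_le_of_le_one_left (by positivity) hx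
  have hunorm : a * ‖WithLp.toLp 2 (u h)‖ ≤ ‖L (u h)‖ := by
    have h1 := hlow (q h) (sum_natFloor_of_real_le hqsum)
    rw [huq, map_smul, WithLp.toLp_smul, norm_smul, norm_smul]
    calc _ = ‖h‖ * (a * ‖WithLp.toLp 2 fun i => (q h i : ℝ)‖) := by ring
      _ ≤ _ := by gcongr
  have hrest : ‖WithLp.toLp 2 (x - u h)‖ ≤ h ^ (1 - p / 2) := by
    rw [EuclideanSpace.norm_eq]
    have hsq : h ^ (1 - p / 2) = √(h ^ (2 - p)) := by
      rw [Real.sqrt_eq_rpow, ← Real.rpow_mul hh.le]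
      ring_nf
    rw [hsq]
    refine Real.sqrt_le_sqrt ?_
    calc ∑ i, ‖(WithLp.toLp 2 (x - u h)) i‖ ^ 2 ≤ ∑ i, h ^ (2 - p) * |x i| ^ p := by
          refine Finset.sum_le_sum fun i _ => ?_
          have h1 : |x i - u h i| ≤ h := hux h hh i
          have h2 : |x i - u h i| ≤ |x i| := by
            have h3 : x i - u h i = h * (x i / h - truncInt (x i / h)) := by
              simp only [hu, hq]
              field_simp
            have h4 : |x i| = h * |x i / h| := by
              rw [abs_div, abs_of_pos hh]
              field_simp
            rw [h3, abs_mul, abs_of_pos hh, h4]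
            exact mul_le_mul_of_nonneg_left (abs_sub_truncInt_le_abs _) hh.le
          have h5 : ‖(WithLp.toLp 2 (x - u h)) i‖ = |x i - u h i| := rfl
          rw [h5]
          calc |x i - u h i| ^ 2 = |x i - u h i| ^ (2 - p) * |x i - u h i| ^ p := by
                rw [← Real.rpow_add_of_nonneg (abs_nonneg _) (by linarith) hp0.le,
                  sub_add_cancel, Real.rpow_two]
            _ ≤ _ := by gcongr
      _ ≤ h ^ (2 - p) := by
          rw [← Finset.mul_sum]
          exact mul_le_of_le_one_right (by positivity) hx
  have hfinal : ‖WithLp.toLp 2 (u h)‖ ≤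
      b / a * (G + K) * (μ * h ^ (1 - p / 2) + (N : ℝ) ^ (1 - 1 / p)) := by
    have := hunorm.trans hLu
    rw [← le_div_iff₀' ha] at this
    refine this.trans_eq ?_
    ring
  calc ‖WithLp.toLp 2 x‖ = ‖WithLp.toLp 2 (x - u h) + WithLp.toLp 2 (u h)‖ := by
        rw [← WithLp.toLp_add, sub_add_cancel]
    _ ≤ _ := (norm_add_le _ _).trans (add_le_add hrest hfinal)

/-- The linear map given by the sign matrix `A`. -/
noncomputable def signLin {m N : ℕ} (A : Fin m → Fin N → Bool) :
    (Fin N → ℝ) →ₗ[ℝ] EuclideanSpace ℝ (Fin m) where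
  toFun x := WithLp.toLp 2 fun k => signedSum x (A k)
  map_add' x y := by
    ext k
    simp [signedSum, mul_add, Finset.sum_add_distrib]
  map_smul' t x := by
    ext k
    exact signedSum_smul t x (A k)

theorem norm_signLin {m N : ℕ} (A : Fin m → Fin N → Bool) (x : Fin N → ℝ) :
    ‖signLin A x‖ = √(signMatrixNormSq A x) := by
  rw [EuclideanSpace.norm_eq]
  simp [signLin, signMatrixNormSq]

theorem div_rpow_le_mul_rpow {p m n : ℝ} (hp1 : 1 < p) (hm : 0 < m) (hmn : m ≤ n) :
    (n ^ (1 - 1 / p) / m) ^ (1 - p / 2) ≤ n ^ (1 - 1 / p) * m ^ (-(1 : ℝ) / 2) := by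
  have hn : 0 < n := hm.trans_le hmn
  have hp0 : p ≠ 0 := by linarith
  calc (n ^ (1 - 1 / p) / m) ^ (1 - p / 2)
      = n ^ ((1 - 1 / p) * (1 - p / 2)) * (m ^ (-(1 : ℝ) / 2) * m ^ ((p - 1) / 2)) := by
        rw [div_eq_mul_inv, Real.mul_rpow (by positivity) (by positivity), ← Real.rpow_mul hn.le,
          ← Real.rpow_add hm, ← Real.rpow_neg_one, ← Real.rpow_mul hm.le]
        congr 2
        ring
    _ ≤ n ^ ((1 - 1 / p) * (1 - p / 2)) * (m ^ (-(1 : ℝ) / 2) * n ^ ((p - 1) / 2)) := by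
        have : 0 ≤ (p - 1) / 2 := by linarith
        gcongr
    _ = n ^ (1 - 1 / p) * m ^ (-(1 : ℝ) / 2) := by
        rw [mul_left_comm, ← Real.rpow_add hn, mul_comm]
        congr 2
        field_simp
        ring

/-- Real form of the upper bound: the kernel of a suitable `m × N` sign matrix meets the `ℓ_p`-ball
in a set of Euclidean radius of order `N ^ (1 - 1 / p) * m ^ (-1 / 2)`. -/
theorem exists_signMatrix_ker_norm_le {p : ℝ} (hp1 : 1 < p) (hp2 : p < 2) :
    ∃ K : ℝ, 0 < K ∧ ∀ m N : ℕ, 1 ≤ m → m ≤ N → ∃ A : Fin m → Fin N → Bool,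
      ∀ x : Fin N → ℝ, ∑ i, |x i| ^ p ≤ 1 → signLin A x = 0 →
        ‖WithLp.toLp 2 x‖ ≤ K * ((N : ℝ) ^ (1 - 1 / p) * (m : ℝ) ^ (-(1 : ℝ) / 2)) := by
  have hp0 : 0 < p := by linarith
  have hinv : 1 / p < 1 := (div_lt_one hp0).2 hp1
  have hδ0 : 0 < 1 - 1 / p := sub_pos.2 hinv
  have hδ1 : 1 - 1 / p ≤ 1 := by linarith [one_div_pos.2 hp0]
  obtain ⟨β, C, hβ, hC, hex⟩ := exists_signMatrix hδ0 hδ1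
  obtain ⟨D, hD, hker⟩ := exists_norm_le_of_ker hp1 hp2
  have hδ' : 1 - (1 - 1 / p) = 1 / p := by ring
  simp only [hδ'] at hex
  set κ : ℝ := max 1 β⁻¹ with hκ
  have hκ1 : 1 ≤ κ := le_max_left _ _
  have hκ0 : 0 < κ := by linarith
  have hκβ : 1 ≤ κ * β := by
    calc 1 = β⁻¹ * β := (inv_mul_cancel₀ hβ.ne').symm
      _ ≤ κ * β := by
        gcongr
        exact le_max_right _ _
  set Q : ℝ := √C / √β * D with hQ
  have hQ0 : 0 < Q := by positivity
  refine ⟨κ * (1 + Q) + Q, by positivity, fun m N hm hmN => ?_⟩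
  have hm0 : (0 : ℝ) < m := by exact_mod_cast hm
  have hN0 : (0 : ℝ) < N := by exact_mod_cast hm.trans hmN
  have hmN' : (m : ℝ) ≤ N := by exact_mod_cast hmN
  set W : ℝ := (N : ℝ) ^ (1 - 1 / p) with hW
  have hW0 : 0 < W := by positivity
  set h : ℝ := κ * (W / m) with hh
  have hh0 : 0 < h := by positivity
  have hhinv : h⁻¹ ≤ (N : ℝ) ^ (1 / p) := by
    have hWN : W * (N : ℝ) ^ (1 / p) = N := by
      rw [hW, ← Real.rpow_add hN0]
      simp
    rw [inv_le_iff_one_le_mul₀ hh0]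
    calc (1 : ℝ) ≤ N / m := (one_le_div hm0).2 hmN'
      _ = 1 * (W / m) * (N : ℝ) ^ (1 / p) := by
        rw [one_mul, div_mul_eq_mul_div, hWN]
      _ ≤ h * (N : ℝ) ^ (1 / p) := by
        rw [hh]
        gcongr
      _ = _ := mul_comm _ _
  have hpow : h ^ (-p) = h⁻¹ ^ p := by
    rw [Real.rpow_neg hh0.le, Real.inv_rpow hh0.le]
  have hS : ⌊h ^ (-p)⌋₊ ≤ N := by
    refine Nat.floor_le_of_le ?_
    rw [hpow]
    calc h⁻¹ ^ p ≤ ((N : ℝ) ^ (1 / p)) ^ p := by gcongr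
      _ = N := by
        rw [← Real.rpow_mul hN0.le, one_div_mul_cancel hp0.ne', Real.rpow_one]
  have hSβ : W * (⌊h ^ (-p)⌋₊ : ℝ) ^ (1 / p) ≤ β * m := by
    have h1 : (⌊h ^ (-p)⌋₊ : ℝ) ^ (1 / p) ≤ h⁻¹ := by
      calc (⌊h ^ (-p)⌋₊ : ℝ) ^ (1 / p) ≤ (h⁻¹ ^ p) ^ (1 / p) := by
            gcongr
            rw [← hpow]
            exact Nat.floor_le (by positivity)
        _ = h⁻¹ := by
            rw [← Real.rpow_mul (by positivity), mul_one_div_cancel hp0.ne', Real.rpow_one]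
    calc W * (⌊h ^ (-p)⌋₊ : ℝ) ^ (1 / p) ≤ W * h⁻¹ := by gcongr
      _ = m / κ := by
        rw [hh]
        field_simp
      _ ≤ β * m := by
        rw [div_le_iff₀ hκ0]
        nlinarith
  obtain ⟨A, hlow, hup⟩ := hex m N _ hm hS hSβ
  refine ⟨A, fun x hx hAx => ?_⟩
  have hnorm : ∀ v : Fin N → ℤ, ‖WithLp.toLp 2 fun i => (v i : ℝ)‖ = √(∑ i, (v i : ℝ) ^ 2) :=
    fun v => by
      rw [EuclideanSpace.norm_eq]
      simp
  have key := hker N (hm.trans hmN) _ (signLin A) h √(β * m) √C √m hh0 (by positivity)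
    (by positivity) (by positivity)
    (fun v hv => by
      rw [hnorm, norm_signLin, ← Real.sqrt_mul (by positivity)]
      exact Real.sqrt_le_sqrt (hlow v hv))
    (fun s hs v hv => by
      rw [hnorm, norm_signLin]
      refine (Real.sqrt_le_sqrt (hup s hs v hv)).trans ?_
      rw [Real.sqrt_mul (by positivity), Real.sqrt_mul hC.le]
      gcongr
      have hF : W ^ (1 / 2 : ℝ) * ((s : ℝ) ^ (1 / p)) ^ (1 / 2 : ℝ) =
          (N : ℝ) ^ ((1 - 1 / p) / 2) * (s : ℝ) ^ ((1 / p) / 2) := by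
        rw [hW, ← Real.rpow_mul hN0.le, ← Real.rpow_mul s.cast_nonneg]
        ring_nf
      rw [← hF, ← Real.mul_rpow hW0.le (by positivity), Real.sqrt_eq_rpow, Real.sqrt_eq_rpow]
      exact Real.rpow_add_le_add_rpow (by positivity) (by positivity) (by norm_num) (by norm_num))
    x hx hAx
  have hmhalf : (m : ℝ) ^ (-(1 : ℝ) / 2) = (√m)⁻¹ := by
    rw [neg_div, Real.rpow_neg hm0.le, Real.sqrt_eq_rpow]
  set Y : ℝ := W * (m : ℝ) ^ (-(1 : ℝ) / 2) with hY
  have hhθ : h ^ (1 - p / 2) ≤ κ * Y := by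
    rw [hh, Real.mul_rpow hκ0.le (by positivity)]
    gcongr
    · calc κ ^ (1 - p / 2) ≤ κ ^ (1 : ℝ) :=
            Real.rpow_le_rpow_of_exponent_le hκ1 (by linarith)
        _ = κ := Real.rpow_one κ
    · exact div_rpow_le_mul_rpow hp1 hm0 hmN'
  have hsm : 0 < √(m : ℝ) := Real.sqrt_pos.2 hm0
  calc _ ≤ _ := key
    _ = (1 + Q) * h ^ (1 - p / 2) + Q * Y := by
      rw [hY, hmhalf, hQ, Real.sqrt_mul hβ.le, ← hW]
      generalize h ^ (1 - p / 2) = z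
      field_simp
      ring
    _ ≤ (1 + Q) * (κ * Y) + Q * Y := by gcongr
    _ = _ := by ring

theorem lpNorm_nonneg (p : ℝ≥0∞) {N : ℕ} (x : Fin N → ℂ) : 0 ≤ lpNorm p x := by
  unfold lpNorm
  split_ifs
  · exact Real.iSup_nonneg fun i => norm_nonneg _
  · positivity

theorem rpow_le_one_iff_of_exponent_pos {x z : ℝ} (hx : 0 ≤ x) (hz : 0 < z) :
    x ^ z ≤ 1 ↔ x ≤ 1 :=
  ⟨fun h => not_lt.1 fun hx1 => h.not_gt (Real.one_lt_rpow hx1 hz),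
    fun h => Real.rpow_le_one hx h hz.le⟩

theorem lpNorm_le_one_iff {p : ℝ≥0∞} (hp0 : p ≠ 0) (hp : p ≠ ∞) {N : ℕ} (x : Fin N → ℂ) :
    lpNorm p x ≤ 1 ↔ ∑ i, ‖x i‖ ^ p.toReal ≤ 1 := by
  have h : 0 < p.toReal := ENNReal.toReal_pos hp0 hp
  rw [lpNorm, if_neg hp]
  exact rpow_le_one_iff_of_exponent_pos (Finset.sum_nonneg fun i _ => by positivity) (by positivity)

theorem norm_apply_le_lpNorm {p : ℝ≥0∞} (hp0 : p ≠ 0) {N : ℕ} (x : Fin N → ℂ) (i : Fin N) :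
    ‖x i‖ ≤ lpNorm p x := by
  unfold lpNorm
  split_ifs with hp
  · exact le_ciSup (f := fun i => ‖x i‖) (Set.finite_range _).bddAbove i
  · have h : 0 < p.toReal := ENNReal.toReal_pos hp0 hp
    calc ‖x i‖ = (‖x i‖ ^ p.toReal) ^ (1 / p.toReal) := by
          rw [← Real.rpow_mul (norm_nonneg _), mul_one_div_cancel h.ne', Real.rpow_one]
      _ ≤ _ := by
          gcongr
          exact Finset.single_le_sum (f := fun i => ‖x i‖ ^ p.toReal)
            (fun i _ => by positivity) (Finset.mem_univ i)

theorem lpNorm_le_norm_toLp_two {p : ℝ≥0∞} (hp : 2 < p) {N : ℕ} (x : Fin N → ℂ) :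
    lpNorm p x ≤ ‖WithLp.toLp 2 x‖ := by
  have hle : ∀ i, ‖x i‖ ≤ ‖WithLp.toLp 2 x‖ := fun i => PiLp.norm_apply_le (WithLp.toLp 2 x) i
  unfold lpNorm
  split_ifs with hpt
  · exact Real.iSup_le hle (norm_nonneg _)
  · set T : ℝ := ‖WithLp.toLp 2 x‖ with hT
    have hT0 : 0 ≤ T := norm_nonneg _
    have hr : 2 < p.toReal := by
      rw [← ENNReal.toReal_ofNat 2]
      exact (ENNReal.toReal_lt_toReal (by simp) hpt).2 hp
    have hsq : ∑ i, ‖x i‖ ^ 2 = T ^ 2 := by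
      rw [hT, EuclideanSpace.norm_sq_eq]
    have hsplit : ∀ y : ℝ, 0 ≤ y → y ^ p.toReal = y ^ (p.toReal - 2) * y ^ 2 := fun y hy => by
      rw [← Real.rpow_two, ← Real.rpow_add_of_nonneg hy (by linarith) (by norm_num),
        sub_add_cancel]
    calc (∑ i, ‖x i‖ ^ p.toReal) ^ (1 / p.toReal) ≤ (T ^ p.toReal) ^ (1 / p.toReal) := by
          gcongr
          rw [hsplit T hT0, ← hsq, Finset.mul_sum]
          refine Finset.sum_le_sum fun i _ => ?_
          rw [hsplit _ (norm_nonneg _)]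
          have := sub_pos.2 hr
          gcongr
          exact hle i
      _ = T := by
          rw [← Real.rpow_mul hT0, mul_one_div_cancel (by linarith), Real.rpow_one]

theorem norm_toLp_two_le_one {p : ℝ} (hp0 : 0 < p) (hp2 : p ≤ 2) {N : ℕ} {x : Fin N → ℂ}
    (hx : ∑ i, ‖x i‖ ^ p ≤ 1) : ‖WithLp.toLp 2 x‖ ≤ 1 := by
  rw [EuclideanSpace.norm_eq]
  refine Real.sqrt_le_one.2 (le_trans (Finset.sum_le_sum fun i _ => ?_) hx)
  have h1 : ‖x i‖ ≤ 1 := by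
    rw [← rpow_le_one_iff_of_exponent_pos (norm_nonneg _) hp0]
    exact (Finset.single_le_sum (f := fun i => ‖x i‖ ^ p) (fun i _ => by positivity)
      (Finset.mem_univ i)).trans hx
  rw [← Real.rpow_two]
  exact Real.rpow_le_rpow_of_exponent_ge_of_imp (norm_nonneg _) h1 hp2 (by intros; linarith)

theorem bddAbove_lpNorm {p1 p2 : ℝ≥0∞} (hp1 : 1 < p1) (hp12 : p1 < 2) (hp2 : 2 < p2) {N : ℕ}
    (M : Submodule ℂ (Fin N → ℂ)) :
    1 ∈ upperBounds { t : ℝ | ∃ x ∈ M, lpNorm p1 x ≤ 1 ∧ t = lpNorm p2 x } := by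
  rintro t ⟨x, -, hx, rfl⟩
  have h0 : p1 ≠ 0 := (zero_lt_one.trans hp1).ne'
  have ht : p1 ≠ ∞ := hp12.ne_top
  refine (lpNorm_le_norm_toLp_two hp2 x).trans (norm_toLp_two_le_one (ENNReal.toReal_pos h0 ht) ?_
    ((lpNorm_le_one_iff h0 ht x).1 hx))
  rw [← ENNReal.toReal_ofNat 2]
  exact ENNReal.toReal_mono (by simp) hp12.le

theorem zero_mem_lpNorm_image {p1 p2 : ℝ≥0∞} (hp1 : 1 < p1) (hp12 : p1 < 2) (hp2 : 2 < p2) {N : ℕ}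
    (M : Submodule ℂ (Fin N → ℂ)) :
    0 ∈ { t : ℝ | ∃ x ∈ M, lpNorm p1 x ≤ 1 ∧ t = lpNorm p2 x } := by
  have h0 : p1 ≠ 0 := (zero_lt_one.trans hp1).ne'
  have ht : p1 ≠ ∞ := hp12.ne_top
  refine ⟨0, M.zero_mem, ?_, ?_⟩
  · rw [lpNorm_le_one_iff h0 ht]
    simp [(ENNReal.toReal_pos h0 ht).ne']
  · refine le_antisymm (lpNorm_nonneg _ _) ((lpNorm_le_norm_toLp_two hp2 _).trans_eq ?_)
    simp

/-- A bound for the identity on one subspace bounds the Gelfand number. -/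
theorem gelfandLp_le {p1 p2 : ℝ≥0∞} (hp1 : 1 < p1) (hp12 : p1 < 2) (hp2 : 2 < p2) {N n : ℕ}
    {M : Submodule ℂ (Fin N → ℂ)} (hM : Module.finrank ℂ ((Fin N → ℂ) ⧸ M) < n) {B : ℝ}
    (hB : ∀ x ∈ M, lpNorm p1 x ≤ 1 → lpNorm p2 x ≤ B) : gelfandLp p1 p2 N n ≤ B := by
  unfold gelfandLp
  refine le_trans (csInf_le ⟨0, ?_⟩ ⟨M, hM, rfl⟩)
    (csSup_le ⟨0, zero_mem_lpNorm_image hp1 hp12 hp2 M⟩ ?_)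
  · rintro r ⟨M', -, rfl⟩
    exact le_csSup ⟨1, bddAbove_lpNorm hp1 hp12 hp2 M'⟩ (zero_mem_lpNorm_image hp1 hp12 hp2 M')
  · rintro t ⟨x, hxM, hx, rfl⟩
    exact hB x hxM hx

theorem le_gelfandLp {p1 p2 : ℝ≥0∞} (hp1 : 1 < p1) (hp12 : p1 < 2) (hp2 : 2 < p2) {N n : ℕ}
    (hn : 1 ≤ n) {B : ℝ}
    (hB : ∀ M : Submodule ℂ (Fin N → ℂ), Module.finrank ℂ ((Fin N → ℂ) ⧸ M) < n →
      ∃ x ∈ M, lpNorm p1 x ≤ 1 ∧ B ≤ lpNorm p2 x) : B ≤ gelfandLp p1 p2 N n := by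
  refine le_csInf ⟨_, ⊤, ?_, rfl⟩ ?_
  · rw [Module.finrank_zero_of_subsingleton]
    exact hn
  · rintro r ⟨M, hM, rfl⟩
    obtain ⟨x, hxM, hx, hBx⟩ := hB M hM
    exact hBx.trans (le_csSup ⟨1, bddAbove_lpNorm hp1 hp12 hp2 M⟩ ⟨x, hxM, hx, rfl⟩)

/-- The complex linear map given by the sign matrix `A`. -/
noncomputable def signLinComplex {m N : ℕ} (A : Fin m → Fin N → Bool) :
    (Fin N → ℂ) →ₗ[ℂ] (Fin m → ℂ) :=
  Matrix.mulVecLin (Matrix.of fun k i => (boolSign (A k i) : ℂ))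

theorem finrank_quotient_ker_signLinComplex_le {m N : ℕ} (A : Fin m → Fin N → Bool) :
    Module.finrank ℂ ((Fin N → ℂ) ⧸ LinearMap.ker (signLinComplex A)) ≤ m := by
  rw [(signLinComplex A).quotKerEquivRange.finrank_eq]
  exact (Submodule.finrank_le _).trans_eq (by simp)

theorem signLin_re_im_eq_zero {m N : ℕ} {A : Fin m → Fin N → Bool} {x : Fin N → ℂ}
    (hx : signLinComplex A x = 0) :
    signLin A (fun i => (x i).re) = 0 ∧ signLin A (fun i => (x i).im) = 0 := by
  have h : ∀ k, ∑ i, (boolSign (A k i) : ℂ) * x i = 0 := fun k => congrFun hx k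
  constructor
  · ext k
    simpa [signLin, signedSum] using congrArg Complex.re (h k)
  · ext k
    simpa [signLin, signedSum] using congrArg Complex.im (h k)

/-- Upper bound for Gelfand numbers through the kernel of a sign matrix. -/
theorem exists_gelfandLp_succ_le {p1 p2 : ℝ≥0∞} (hp1 : 1 < p1) (hp12 : p1 < 2) (hp2 : 2 < p2) :
    ∃ K : ℝ, 0 < K ∧ ∀ m N : ℕ, 1 ≤ m → m ≤ N → gelfandLp p1 p2 N (m + 1) ≤
      K * ((N : ℝ) ^ (1 - 1 / p1.toReal) * (m : ℝ) ^ (-(1 : ℝ) / 2)) := by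
  have h0 : p1 ≠ 0 := (zero_lt_one.trans hp1).ne'
  have ht : p1 ≠ ∞ := hp12.ne_top
  have hr1 : 1 < p1.toReal := by
    rw [← ENNReal.toReal_one]
    exact (ENNReal.toReal_lt_toReal (by simp) ht).2 hp1
  have hr2 : p1.toReal < 2 := by
    rw [← ENNReal.toReal_ofNat 2]
    exact (ENNReal.toReal_lt_toReal ht (by simp)).2 hp12
  obtain ⟨K, hK, hex⟩ := exists_signMatrix_ker_norm_le hr1 hr2
  refine ⟨2 * K, by positivity, fun m N hm hmN => ?_⟩
  obtain ⟨A, hA⟩ := hex m N hm hmN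
  refine gelfandLp_le hp1 hp12 hp2
    (Nat.lt_succ_of_le (finrank_quotient_ker_signLinComplex_le A)) fun x hxM hx => ?_
  rw [lpNorm_le_one_iff h0 ht] at hx
  obtain ⟨hre, him⟩ := signLin_re_im_eq_zero (LinearMap.mem_ker.1 hxM)
  have hre' := hA _ ((Finset.sum_le_sum fun i _ => by
    gcongr; exact Complex.abs_re_le_norm _).trans hx) hre
  have him' := hA _ ((Finset.sum_le_sum fun i _ => by
    gcongr; exact Complex.abs_im_le_norm _).trans hx) him
  set Y : ℝ := K * ((N : ℝ) ^ (1 - 1 / p1.toReal) * (m : ℝ) ^ (-(1 : ℝ) / 2)) with hY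
  have hY0 : 0 ≤ Y := by positivity
  have hsq : ‖WithLp.toLp 2 x‖ ^ 2 =
      ‖WithLp.toLp 2 fun i => (x i).re‖ ^ 2 + ‖WithLp.toLp 2 fun i => (x i).im‖ ^ 2 := by
    simp only [EuclideanSpace.norm_sq_eq, ← Finset.sum_add_distrib]
    refine Finset.sum_congr rfl fun i _ => ?_
    rw [Complex.sq_norm, Complex.normSq_apply]
    simp
    ring
  refine (lpNorm_le_norm_toLp_two hp2 x).trans ?_
  rw [mul_assoc, ← hY]
  refine le_of_sq_le_sq ?_ (by positivity)
  rw [hsq]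
  nlinarith [pow_le_pow_left₀ (norm_nonneg _) hre' 2, pow_le_pow_left₀ (norm_nonneg _) him' 2]

theorem sum_norm_sq_orthogonalProjection {N : ℕ} (U : Submodule ℂ (EuclideanSpace ℂ (Fin N))) :
    ∑ i, ‖U.orthogonalProjectionOnto (EuclideanSpace.basisFun (Fin N) ℂ i)‖ ^ 2 =
      Module.finrank ℂ U := by
  set b := stdOrthonormalBasis ℂ U
  simp_rw [← b.sum_sq_norm_inner_right, Submodule.inner_orthogonalProjectionOnto_eq_of_mem_left]
  rw [Finset.sum_comm]
  simp_rw [OrthonormalBasis.sum_sq_norm_inner_left]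
  have hb : ∀ j, ‖((b j : U) : EuclideanSpace ℂ (Fin N))‖ = 1 := fun j => b.orthonormal.1 j
  simp [hb]

theorem sum_rpow_rpow_le {p : ℝ} (hp0 : 0 < p) (hp2 : p ≤ 2) {N : ℕ} (z : Fin N → ℝ)
    (hz : ∀ i, 0 ≤ z i) :
    (∑ i, z i ^ p) ^ (1 / p) ≤ (N : ℝ) ^ (1 / p - 1 / 2) * √(∑ i, z i ^ 2) := by
  have h := Real.rpow_sum_le_const_mul_sum_rpow_of_nonneg Finset.univ (f := fun i => z i ^ p)
    (p := 2 / p) ((one_le_div hp0).2 hp2) fun i _ => Real.rpow_nonneg (hz i) p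
  have hzp : ∀ i, (z i ^ p) ^ (2 / p) = z i ^ 2 := fun i => by
    rw [← Real.rpow_mul (hz i), mul_div_cancel₀ _ hp0.ne', Real.rpow_two]
  simp only [Finset.card_univ, Fintype.card_fin, hzp] at h
  have hs : 0 ≤ ∑ i, z i ^ p := Finset.sum_nonneg fun i _ => Real.rpow_nonneg (hz i) p
  calc (∑ i, z i ^ p) ^ (1 / p) = √((∑ i, z i ^ p) ^ (2 / p)) := by
        rw [Real.sqrt_eq_rpow, ← Real.rpow_mul hs]
        congr 1
        ring
    _ ≤ √((N : ℝ) ^ (2 / p - 1) * ∑ i, z i ^ 2) := Real.sqrt_le_sqrt h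
    _ = _ := by
        rw [Real.sqrt_mul (by positivity), Real.sqrt_eq_rpow, ← Real.rpow_mul (by positivity)]
        congr 2
        ring

theorem lpNorm_smul {p : ℝ≥0∞} (hp0 : p ≠ 0) (hp : p ≠ ∞) {N : ℕ} (a : ℂ) (x : Fin N → ℂ) :
    lpNorm p (a • x) = ‖a‖ * lpNorm p x := by
  have h : 0 < p.toReal := ENNReal.toReal_pos hp0 hp
  simp only [lpNorm, if_neg hp, Pi.smul_apply, smul_eq_mul, norm_mul]
  simp_rw [Real.mul_rpow (norm_nonneg _) (norm_nonneg _)]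
  rw [← Finset.mul_sum, Real.mul_rpow (by positivity) (by positivity),
    ← Real.rpow_mul (norm_nonneg _), mul_one_div_cancel h.ne', Real.rpow_one]

theorem lpNorm_sub_le {p : ℝ≥0∞} (hp1 : 1 < p) (hp : p ≠ ∞) {N : ℕ} (x y : Fin N → ℂ) :
    lpNorm p (x - y) ≤ lpNorm p x + lpNorm p y := by
  have h : 1 ≤ p.toReal := by
    rw [← ENNReal.toReal_one]
    exact ENNReal.toReal_mono hp hp1.le
  simp only [lpNorm, if_neg hp]
  refine le_trans ?_ (Real.Lp_add_le_of_nonneg Finset.univ h (fun i _ => norm_nonneg (x i))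
    fun i _ => norm_nonneg (y i))
  gcongr
  exact norm_sub_le _ _

/-- A subspace of codimension less than `n` contains a vector close to a unit vector. -/
theorem exists_single_sub_mem {N n : ℕ} (hn : 1 ≤ n) (hnN : n ≤ N)
    (M : Submodule ℂ (Fin N → ℂ)) (hM : Module.finrank ℂ ((Fin N → ℂ) ⧸ M) < n) :
    ∃ (i : Fin N) (q : Fin N → ℂ), Pi.single i 1 - q ∈ M ∧ ∑ j, ‖q j‖ ^ 2 ≤ (n : ℝ) / N := by
  set e := (WithLp.linearEquiv 2 ℂ (Fin N → ℂ)).symm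
  set K : Submodule ℂ (EuclideanSpace ℂ (Fin N)) := M.map e.toLinearMap with hK
  have hfin : Module.finrank ℂ Kᗮ < n := by
    have h1 := Submodule.finrank_add_finrank_orthogonal K
    have h2 := Submodule.finrank_quotient_add_finrank M
    have h3 : Module.finrank ℂ K = Module.finrank ℂ M := LinearEquiv.finrank_map_eq e M
    simp only [finrank_euclideanSpace, Module.finrank_fin_fun, Fintype.card_fin] at h1 h2
    omega
  have hN : (0 : ℝ) < N := by exact_mod_cast hn.trans hnN
  have : Nonempty (Fin N) := ⟨⟨0, hn.trans hnN⟩⟩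
  obtain ⟨i, -, hi⟩ := Finset.exists_le_of_sum_le (s := Finset.univ)
    (f := fun i => ‖Kᗮ.orthogonalProjectionOnto (EuclideanSpace.basisFun (Fin N) ℂ i)‖ ^ 2)
    (g := fun _ => (n : ℝ) / N) Finset.univ_nonempty (by
      rw [sum_norm_sq_orthogonalProjection]
      simp only [Finset.sum_const, Finset.card_univ, Fintype.card_fin, nsmul_eq_mul]
      rw [mul_div_cancel₀ _ hN.ne']
      exact_mod_cast hfin.le)
  set q := Kᗮ.orthogonalProjectionOnto (EuclideanSpace.basisFun (Fin N) ℂ i)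
  refine ⟨i, WithLp.ofLp (q : EuclideanSpace ℂ (Fin N)), ?_, ?_⟩
  · have h := Submodule.sub_starProjection_mem_orthogonal (K := Kᗮ)
      (EuclideanSpace.basisFun (Fin N) ℂ i)
    rw [Submodule.orthogonal_orthogonal] at h
    obtain ⟨y, hy, hye⟩ := h
    have : y = Pi.single i 1 - WithLp.ofLp (q : EuclideanSpace ℂ (Fin N)) := by
      rw [show y = WithLp.ofLp (e y) from rfl]
      have hye' : e y = _ := hye
      rw [hye']
      simp [q]
    rwa [← this]
  · rw [← EuclideanSpace.norm_sq_eq]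
    exact hi

/-- Lower bound for Gelfand numbers. -/
theorem min_le_gelfandLp {p1 p2 : ℝ≥0∞} (hp1 : 1 < p1) (hp12 : p1 < 2) (hp2 : 2 < p2) {N n : ℕ}
    (hn : 1 ≤ n) (hnN : (n : ℝ) ≤ (N : ℝ) / 4) :
    (1 / 4 : ℝ) * min 1 ((N : ℝ) ^ (1 - 1 / p1.toReal) * (n : ℝ) ^ (-(1 : ℝ) / 2)) ≤
      gelfandLp p1 p2 N n := by
  have h0 : p1 ≠ 0 := (zero_lt_one.trans hp1).ne'
  have ht : p1 ≠ ∞ := hp12.ne_top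
  have hr0 : 0 < p1.toReal := ENNReal.toReal_pos h0 ht
  have hr2 : p1.toReal ≤ 2 := by
    rw [← ENNReal.toReal_ofNat 2]
    exact ENNReal.toReal_mono (by simp) hp12.le
  have hn0 : (0 : ℝ) < n := by exact_mod_cast hn
  have hN0 : (0 : ℝ) < N := by linarith
  have hnN' : n ≤ N := by
    have : (n : ℝ) ≤ N := by linarith
    exact_mod_cast this
  set Z : ℝ := (N : ℝ) ^ (1 - 1 / p1.toReal) * (n : ℝ) ^ (-(1 : ℝ) / 2) with hZ
  have hZ0 : 0 < Z := by positivity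
  refine le_gelfandLp hp1 hp12 hp2 hn fun M hM => ?_
  obtain ⟨i, q, hqM, hq⟩ := exists_single_sub_mem hn hnN' M hM
  set x : Fin N → ℂ := Pi.single i 1 - q with hx
  have hquarter : (n : ℝ) / N ≤ 1 / 4 := by
    rw [div_le_div_iff₀ hN0 (by norm_num)]
    linarith
  have hqi : ‖q i‖ ≤ 1 / 2 := by
    have := Finset.single_le_sum (f := fun j => ‖q j‖ ^ 2) (fun j _ => by positivity)
      (Finset.mem_univ i)
    refine le_of_sq_le_sq ?_ (by norm_num)
    linarith
  have hxi : 1 / 2 ≤ ‖x i‖ := by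
    have h := norm_sub_norm_le (1 : ℂ) (q i)
    rw [norm_one] at h
    have : x i = 1 - q i := by simp [hx]
    rw [this]
    linarith
  have hsingle : lpNorm p1 (Pi.single i 1 : Fin N → ℂ) ≤ 1 := by
    rw [lpNorm_le_one_iff h0 ht, Finset.sum_eq_single i]
    · simp
    · intro j _ hj
      simp [Pi.single_eq_of_ne hj, hr0.ne']
    · simp
  have hqnorm : lpNorm p1 q ≤ Z⁻¹ := by
    rw [lpNorm, if_neg ht]
    calc _ ≤ (N : ℝ) ^ (1 / p1.toReal - 1 / 2) * √(∑ j, ‖q j‖ ^ 2) :=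
          sum_rpow_rpow_le hr0 hr2 _ fun j => norm_nonneg _
      _ ≤ (N : ℝ) ^ (1 / p1.toReal - 1 / 2) * √((n : ℝ) / N) := by gcongr
      _ = Z⁻¹ := by
          rw [hZ, mul_inv, ← Real.rpow_neg hN0.le, ← Real.rpow_neg hn0.le, Real.sqrt_eq_rpow,
            Real.div_rpow hn0.le hN0.le,
            div_eq_mul_inv ((n : ℝ) ^ (1 / 2 : ℝ)), ← Real.rpow_neg hN0.le, mul_left_comm,
            ← Real.rpow_add hN0, mul_comm]
          congr 2 <;> ring
  set B : ℝ := 1 + Z⁻¹ with hB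
  have hB0 : 0 < B := by positivity
  have hxB : lpNorm p1 x ≤ B :=
    (lpNorm_sub_le hp1 ht _ _).trans (add_le_add hsingle hqnorm)
  have hBnorm : ‖((B⁻¹ : ℝ) : ℂ)‖ = B⁻¹ := by
    rw [Complex.norm_real, Real.norm_of_nonneg (by positivity)]
  refine ⟨((B⁻¹ : ℝ) : ℂ) • x, M.smul_mem _ hqM, ?_, ?_⟩
  · rw [lpNorm_smul h0 ht, hBnorm, inv_mul_le_iff₀ hB0, mul_one]
    exact hxB
  · refine le_trans ?_ (norm_apply_le_lpNorm (zero_lt_two.trans hp2).ne' _ i)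
    rw [Pi.smul_apply, norm_smul, hBnorm, ← div_eq_inv_mul, le_div_iff₀ hB0]
    have h1 : min 1 Z ≤ 1 := min_le_left _ _
    have h2 : min 1 Z * Z⁻¹ ≤ 1 := by
      rw [mul_inv_le_iff₀ hZ0, one_mul]
      exact min_le_right _ _
    rw [hB]
    linarith

/-- Upper bound for Gelfand numbers. -/
theorem exists_gelfandLp_le_mul_min {p1 p2 : ℝ≥0∞} (hp1 : 1 < p1) (hp12 : p1 < 2) (hp2 : 2 < p2) :
    ∃ K : ℝ, 1 ≤ K ∧ ∀ N n : ℕ, 1 ≤ n → n ≤ N → gelfandLp p1 p2 N n ≤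
      K * min 1 ((N : ℝ) ^ (1 - 1 / p1.toReal) * (n : ℝ) ^ (-(1 : ℝ) / 2)) := by
  obtain ⟨K, hK, hle⟩ := exists_gelfandLp_succ_le hp1 hp12 hp2
  refine ⟨1 + 2 * K, by linarith, fun N n hn hnN => ?_⟩
  have hone : gelfandLp p1 p2 N n ≤ 1 := by
    refine gelfandLp_le hp1 hp12 hp2 (M := ⊤) ?_ fun x hxM hx =>
      bddAbove_lpNorm hp1 hp12 hp2 ⊤ ⟨x, hxM, hx, rfl⟩
    rw [Module.finrank_zero_of_subsingleton]
    exact hn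
  have hr1 : 1 ≤ p1.toReal := by
    rw [← ENNReal.toReal_one]
    exact ENNReal.toReal_mono hp12.ne_top hp1.le
  have hexp : 0 ≤ 1 - 1 / p1.toReal := sub_nonneg.2 ((div_le_one (by linarith)).2 hr1)
  have hN1 : (1 : ℝ) ≤ N := by exact_mod_cast hn.trans hnN
  rw [mul_min_of_nonneg _ _ (by linarith)]
  refine le_min (by linarith) ?_
  obtain ⟨m, rfl⟩ : ∃ m, n = m + 1 := ⟨n - 1, by omega⟩
  rcases Nat.eq_zero_or_pos m with rfl | hm
  · have := Real.one_le_rpow hN1 hexp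
    simp only [zero_add, Nat.cast_one, Real.one_rpow, mul_one]
    nlinarith
  · have hm0 : (1 : ℝ) ≤ m := by exact_mod_cast hm
    have hm' : (m : ℝ) ^ (-(1 : ℝ) / 2) ≤ 2 * ((m + 1 : ℕ) : ℝ) ^ (-(1 : ℝ) / 2) := by
      calc (m : ℝ) ^ (-(1 : ℝ) / 2) ≤ (4⁻¹ * ((m + 1 : ℕ) : ℝ)) ^ (-(1 : ℝ) / 2) := by
            refine Real.rpow_le_rpow_of_nonpos (by positivity) ?_ (by norm_num)
            push_cast
            linarith
        _ = 2 * ((m + 1 : ℕ) : ℝ) ^ (-(1 : ℝ) / 2) := by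
            rw [Real.mul_rpow (by norm_num) (by positivity),
              show (4⁻¹ : ℝ) = 2 ^ (-2 : ℝ) by rw [Real.rpow_neg (by norm_num)]; norm_num,
              ← Real.rpow_mul (by norm_num)]
            norm_num
    have hNpos : 0 ≤ (N : ℝ) ^ (1 - 1 / p1.toReal) := by positivity
    calc gelfandLp p1 p2 N (m + 1)
        ≤ K * ((N : ℝ) ^ (1 - 1 / p1.toReal) * (m : ℝ) ^ (-(1 : ℝ) / 2)) := hle m N hm (by omega)
      _ ≤ K * ((N : ℝ) ^ (1 - 1 / p1.toReal) *
            (2 * ((m + 1 : ℕ) : ℝ) ^ (-(1 : ℝ) / 2))) := by gcongr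
      _ = 2 * K * ((N : ℝ) ^ (1 - 1 / p1.toReal) *
            ((m + 1 : ℕ) : ℝ) ^ (-(1 : ℝ) / 2)) := by ring
      _ ≤ _ := by
          gcongr
          linarith

/-- Let `1 < p1 < 2 < p2 ≤ ∞`. There is a constant `c > 0`, depending only
on `p1, p2`, such that for all `N` and all `n` with `n ≤ N/4`,
`c⁻¹ min{1, N^{1-1/p1} n^{-1/2}} ≤ c_n(id : ℓ_{p1}^N → ℓ_{p2}^N) ≤ c min{1, N^{1-1/p1} n^{-1/2}}`. -/
theorem gelfand_id_lp_small_large (p1 p2 : ℝ≥0∞) (hp1 : 1 < p1) (hp12 : p1 < 2)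
    (hp2 : 2 < p2) :
    ∃ c : ℝ, 0 < c ∧ ∀ N n : ℕ, 1 ≤ n → (n : ℝ) ≤ (N : ℝ) / 4 →
      c⁻¹ * min 1 ((N : ℝ) ^ (1 - 1 / p1.toReal) * (n : ℝ) ^ (-(1 : ℝ) / 2)) ≤
        gelfandLp p1 p2 N n ∧
      gelfandLp p1 p2 N n ≤
        c * min 1 ((N : ℝ) ^ (1 - 1 / p1.toReal) * (n : ℝ) ^ (-(1 : ℝ) / 2)) := by
  obtain ⟨K, hK, hle⟩ := exists_gelfandLp_le_mul_min hp1 hp12 hp2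
  refine ⟨4 * K, by linarith, fun N n hn hnN => ?_⟩
  have hnN' : n ≤ N := by
    have : (n : ℝ) ≤ N := by linarith [Nat.cast_nonneg (α := ℝ) N]
    exact_mod_cast this
  have hmin : 0 ≤ min 1 ((N : ℝ) ^ (1 - 1 / p1.toReal) * (n : ℝ) ^ (-(1 : ℝ) / 2)) := by
    positivity
  refine ⟨le_trans ?_ (min_le_gelfandLp hp1 hp12 hp2 hn hnN), (hle N n hn hnN').trans ?_⟩
  · gcongr
    rw [one_div]
    gcongr
    linarith
  · gcongr
    linarith
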